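/- (Theorem 4(ii) and 4(iii)) Let q ≡ 11 (mod 12) be a prime power. The 2q vectors r + 2·1̄ ∈ GF(3)^{q+1}, where r ranges over the rows of H_{q+1} and of −H_{q+1} (reduced mod 3) other than the all-one row of H_{q+1} and its negative, are pairwise distinct (0,1)-codewords of QR_q of weight (q+1)/2, and for every set of 3 distinct coordinate positions exactly (q−3)/4 of these 2q vectors have entry 1 at all three positions (so they form a Hadamard 3-(q+1, (q+1)/2, (q−3)/4) design). Moreover, if q ∈ {11, 23, 47}, then these 2q vectors are the only (0,1)-codewords of weight (q+1)/2 in QR_q, and a permutation σ of the q+1 coordinate positions maps QR_q onto itself if and only if σ maps every support of one of these 2q vectors onto the support of another of them. -/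

import Mathlib

open Matrix Finset

/-- The `q × (q+1)` matrix `B`: the (0,1)-incidence matrix `A` of the Paley design
(`A_{a,b} = 1` iff `b − a` is a nonzero square in `GF(q)`), bordered by one all-one
column (indexed by `none`). -/
def Bmat (F : Type) [Field F] [Fintype F] [DecidableEq F] : Matrix F (Option F) ℤ :=
  fun a j =>
    match j with
    | none => 1
    | some b => if quadraticChar F (b - a) = 1 then 1 else 0

/-- The extended ternary quadratic residue code `QR_q`: the span over `GF(3)` of the
rows of `B` reduced modulo 3. -/
def QRcode (F : Type) [Field F] [Fintype F] [DecidableEq F] :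
    Submodule (ZMod 3) (Option F → ZMod 3) :=
  Submodule.span (ZMod 3) (Set.range (fun a : F => fun j => ((Bmat F a j : ℤ) : ZMod 3)))

/-- The `(q+1) × (q+1)` matrix `E`: the matrix `B` with one all-one row appended
(indexed by `none`). -/
def Emat (F : Type) [Field F] [Fintype F] [DecidableEq F] :
    Matrix (Option F) (Option F) ℤ := fun i j =>
  match i with
  | none => 1
  | some a => Bmat F a j

/-- The Paley–Hadamard matrix of type I of order `q+1`: `H_{q+1} = 2E − J`. -/
def HPmat (F : Type) [Field F] [Fintype F] [DecidableEq F] :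
    Matrix (Option F) (Option F) ℤ := fun i j => 2 * Emat F i j - 1

/-- The vector `r + 2·1̄` over `GF(3)`, where `r` is the row of `H_{q+1}` (if `s = true`)
or of `−H_{q+1}` (if `s = false`) indexed by `a ∈ GF(q)` (i.e. a row other than the
all-one row of `H_{q+1}` and its negative), reduced modulo 3. -/
def qvec (F : Type) [Field F] [Fintype F] [DecidableEq F] (s : Bool) (a : F) :
    Option F → ZMod 3 := fun j =>
  (if s then 1 else -1) * ((HPmat F (some a) j : ℤ) : ZMod 3) + 2

section QuadraticCharacter

theorem ringChar_ne_two_of_card {F : Type} [Field F] [Fintype F]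
    (hq : Fintype.card F % 12 = 11) : ringChar F ≠ 2 := by
  intro h
  have := FiniteField.even_card_of_char_two h
  omega

variable {F : Type} [Field F] [Fintype F] [DecidableEq F]

theorem quadraticChar_neg_one_eq (hq : Fintype.card F % 12 = 11) :
    quadraticChar F (-1) = -1 := by
  rw [quadraticChar_neg_one (ringChar_ne_two_of_card hq)]
  exact ZMod.χ₄_nat_three_mod_four (by omega)

theorem quadraticChar_neg_eq (hq : Fintype.card F % 12 = 11) (x : F) :
    quadraticChar F (-x) = -quadraticChar F x := by
  rw [neg_eq_neg_one_mul, map_mul, quadraticChar_neg_one_eq hq, neg_one_mul]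

theorem sum_quadraticChar_sub (hF : ringChar F ≠ 2) (b : F) :
    ∑ a, quadraticChar F (b - a) = 0 := by
  rw [← quadraticChar_sum_zero hF]
  exact Fintype.sum_equiv (Equiv.subLeft b) _ _ fun _ => rfl

theorem sum_quadraticChar_sub' (hF : ringChar F ≠ 2) (b : F) :
    ∑ a, quadraticChar F (a - b) = 0 := by
  rw [← quadraticChar_sum_zero hF]
  exact Fintype.sum_equiv (Equiv.subRight b) _ _ fun _ => rfl

theorem sum_quadraticChar_sub_mul_sub (hF : ringChar F ≠ 2) {b c : F} (h : b ≠ c) :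
    ∑ a, quadraticChar F (b - a) * quadraticChar F (c - a) = -1 := by
  have hd : b - c ≠ 0 := sub_ne_zero.2 h
  have hJ : ∑ x, quadraticChar F x * quadraticChar F (1 - x) = -quadraticChar F (-1) := by
    have := jacobiSum_nontrivial_inv (quadraticChar_ne_one hF)
    rwa [(quadraticChar_isQuadratic F).inv] at this
  have hs : ∑ a, quadraticChar F (b - a) * quadraticChar F (c - a) =
      ∑ x, quadraticChar F (-1) * (quadraticChar F x * quadraticChar F (1 - x)) := by
    refine (Fintype.sum_bijective (fun x => b - (b - c) * x) ?_ _ _ fun x => ?_).symm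
    · exact (Equiv.subLeft b).bijective.comp (mulLeft_bijective₀ _ hd)
    · have e1 : b - (b - (b - c) * x) = (b - c) * x := by ring
      have e2 : c - (b - (b - c) * x) = (b - c) * (-1 * (1 - x)) := by ring
      rw [e1, e2]
      simp only [map_mul]
      have := quadraticChar_sq_one hd
      linear_combination
        (-quadraticChar F x * quadraticChar F (-1) * quadraticChar F (1 - x)) * this
  rw [hs, ← Finset.mul_sum, hJ]
  have := quadraticChar_sq_one (F := F) (a := -1) (by simp)
  linear_combination -this

end QuadraticCharacter

section PaleyRows

variable {F : Type} [Field F] [Fintype F] [DecidableEq F]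

/-- The row of a Paley matrix of type I indexed by `a`, with sign `e` at infinity and `-e` on the
diagonal. -/
def paleyRow (e : ℤ) (a : F) : Option F → ℤ
  | none => e
  | some b => quadraticChar F (b - a) - if b = a then e else 0

theorem paleyRow_eq_one_or (e : ℤ) (he : e = 1 ∨ e = -1) (a : F) (j : Option F) :
    paleyRow e a j = 1 ∨ paleyRow e a j = -1 := by
  rcases j with _ | b
  · exact he
  · by_cases h : b = a
    · subst h
      rcases he with rfl | rfl <;> simp [paleyRow]
    · simpa [paleyRow, h] using quadraticChar_dichotomy (sub_ne_zero.2 h)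

theorem paleyRow_mul_self (e : ℤ) (he : e = 1 ∨ e = -1) (a : F) (j : Option F) :
    paleyRow e a j * paleyRow e a j = 1 := by
  rcases paleyRow_eq_one_or e he a j with h | h <;> rw [h] <;> norm_num

theorem HPmat_some (a : F) (j : Option F) : HPmat F (some a) j = paleyRow 1 a j := by
  rcases j with _ | b
  · simp [HPmat, Emat, Bmat, paleyRow]
  · by_cases h : b = a
    · simp [HPmat, Emat, Bmat, paleyRow, h]
    · rcases quadraticChar_dichotomy (sub_ne_zero.2 h) with h' | h' <;>
        simp [HPmat, Emat, Bmat, paleyRow, h, h']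

theorem sum_paleyRow_mul_of_ne (hq : Fintype.card F % 12 = 11) (e : ℤ) (he : e = 1 ∨ e = -1)
    {j k : Option F} (h : j ≠ k) :
    ∑ a, paleyRow e a j * paleyRow e a k = -1 := by
  have hF := ringChar_ne_two_of_card hq
  have h1 : ∀ b : F, ∑ a, paleyRow e a (some b) = -e := by
    intro b
    simp [-quadraticChar_apply, paleyRow, Finset.sum_sub_distrib, sum_quadraticChar_sub hF]
  have he2 : e * e = 1 := by rcases he with rfl | rfl <;> norm_num
  rcases j with _ | b <;> rcases k with _ | c
  · exact absurd rfl h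
  · change ∑ a, e * paleyRow e a (some c) = -1
    rw [← Finset.mul_sum, h1]
    linarith
  · change ∑ a, paleyRow e a (some b) * e = -1
    rw [← Finset.sum_mul, h1]
    linarith
  · have hbc : b ≠ c := fun H => h (by rw [H])
    have : ∀ a, paleyRow e a (some b) * paleyRow e a (some c) =
        quadraticChar F (b - a) * quadraticChar F (c - a)
          - (if c = a then e * quadraticChar F (b - a) else 0)
          - (if b = a then e * quadraticChar F (c - a) else 0) := by
      intro a
      by_cases h1 : c = a
      · have h2 : b ≠ a := fun H => hbc (H.trans h1.symm)
        simp [paleyRow, h1, h2]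
        ring
      · by_cases h2 : b = a
        · simp [paleyRow, h1, h2]
        · simp [paleyRow, h1, h2]
    simp only [this, Finset.sum_sub_distrib, sum_quadraticChar_sub_mul_sub hF hbc,
      Finset.sum_ite_eq, Finset.mem_univ, if_true]
    rw [← neg_sub c b, quadraticChar_neg_eq hq]
    ring

theorem sum_sq_sum_paleyRow_mul (hq : Fintype.card F % 12 = 11) (e : ℤ) (he : e = 1 ∨ e = -1)
    (x : Option F → ℤ) :
    ∑ a, (∑ j, paleyRow e a j * x j) ^ 2 =
      (Fintype.card F + 1 : ℤ) * ∑ j, x j ^ 2 - (∑ j, x j) ^ 2 := by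
  have h1 : ∀ j k : Option F, ∑ a, paleyRow e a j * paleyRow e a k =
      (if j = k then (Fintype.card F + 1 : ℤ) else 0) - 1 := by
    intro j k
    by_cases h : j = k
    · subst h
      simp [paleyRow_mul_self e he]
    · simp [h, sum_paleyRow_mul_of_ne hq e he h]
  calc ∑ a, (∑ j, paleyRow e a j * x j) ^ 2
      = ∑ j, ∑ k, (∑ a, paleyRow e a j * paleyRow e a k) * (x j * x k) := by
        have h2 : ∀ a, (∑ j, paleyRow e a j * x j) ^ 2 =
            ∑ j, ∑ k, paleyRow e a j * paleyRow e a k * (x j * x k) := by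
          intro a
          rw [sq, Finset.sum_mul_sum]
          exact Finset.sum_congr rfl fun j _ => Finset.sum_congr rfl fun k _ => by ring
        simp only [h2, Finset.sum_mul]
        rw [Finset.sum_comm]
        exact Finset.sum_congr rfl fun j _ => Finset.sum_comm
    _ = _ := by
        rw [sq (∑ j, x j), Finset.sum_mul_sum]
        simp only [h1, sub_mul, Finset.sum_sub_distrib, ite_mul, zero_mul, one_mul,
          Finset.sum_ite_eq, Finset.mem_univ, if_true, sq, Finset.mul_sum]

theorem sum_paleyRow (hq : Fintype.card F % 12 = 11) (a : F) : ∑ j, paleyRow 1 a j = 0 := by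
  have hF := ringChar_ne_two_of_card hq
  simp [-quadraticChar_apply, Fintype.sum_option, paleyRow, Finset.sum_sub_distrib,
    sum_quadraticChar_sub' hF]

theorem sum_paleyRow_mul_paleyRow (hq : Fintype.card F % 12 = 11) {a b : F} (h : a ≠ b) :
    ∑ j, paleyRow 1 a j * paleyRow 1 b j = 0 := by
  have key := sum_paleyRow_mul_of_ne hq (-1) (Or.inr rfl)
    (j := some a) (k := some b) (by simpa using h)
  rw [Fintype.sum_option]
  have : ∀ c, paleyRow 1 a (some c) * paleyRow 1 b (some c) =
      paleyRow (-1) c (some a) * paleyRow (-1) c (some b) := by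
    intro c
    simp only [paleyRow]
    rw [← neg_sub a c, ← neg_sub b c, quadraticChar_neg_eq hq, quadraticChar_neg_eq hq]
    simp only [eq_comm (a := c)]
    split_ifs <;> ring
  simp only [this, key]
  simp [paleyRow]

end PaleyRows

section Code

/-- The row of `B` indexed by `a`, reduced modulo 3. -/
def bRow (F : Type) [Field F] [Fintype F] [DecidableEq F] (a : F) : Option F → ZMod 3 :=
  fun j => ((Bmat F a j : ℤ) : ZMod 3)

theorem comp_mem_QRcode {F K : Type} [Field F] [Fintype F] [DecidableEq F] [Field K] [Fintype K]
    [DecidableEq K] (f : Option K → Option F) (hf : ∀ a, bRow F a ∘ f ∈ QRcode K)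
    {c : Option F → ZMod 3} (hc : c ∈ QRcode F) : c ∘ f ∈ QRcode K := by
  have : QRcode F ≤ (QRcode K).comap (LinearMap.funLeft (ZMod 3) (ZMod 3) f) := by
    refine Submodule.span_le.2 ?_
    rintro _ ⟨a, rfl⟩
    exact hf a
  exact this hc

theorem natCast_card_eq_two {F : Type} [Fintype F] (hq : Fintype.card F % 12 = 11) :
    (Fintype.card F : ZMod 3) = 2 :=
  (ZMod.natCast_eq_natCast_iff' _ 2 3).2 (by omega)

variable {F : Type} [Field F] [Fintype F] [DecidableEq F]

theorem bRow_mem (a : F) : bRow F a ∈ QRcode F := Submodule.subset_span ⟨a, rfl⟩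

@[simp] theorem bRow_none (a : F) : bRow F a none = 1 := by simp [bRow, Bmat]

theorem bRow_some (a b : F) :
    bRow F a (some b) = if quadraticChar F (b - a) = 1 then 1 else 0 := by
  simp only [bRow, Bmat]
  split_ifs <;> simp

theorem bRow_eq (a : F) (j : Option F) : bRow F a j = -((paleyRow 1 a j : ℤ) : ZMod 3) - 1 := by
  have h3 : (3 : ZMod 3) = 0 := rfl
  rw [← HPmat_some]
  simp only [bRow, HPmat, Emat]
  push_cast
  linear_combination (Bmat F a j : ZMod 3) * h3

theorem qvec_false (a : F) : qvec F false a = bRow F a := by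
  have h3 : (3 : ZMod 3) = 0 := rfl
  funext j
  rw [bRow_eq, qvec, HPmat_some]
  simp only [Bool.false_eq_true, if_false]
  linear_combination h3

theorem qvec_true (a : F) : qvec F true a = 1 - bRow F a := by
  funext j
  rw [Pi.sub_apply, bRow_eq, qvec, HPmat_some]
  simp only [if_true, Pi.one_apply]
  ring

theorem qvec_eq_one_iff (s : Bool) (a : F) (j : Option F) :
    qvec F s a j = 1 ↔ paleyRow 1 a j = if s then -1 else 1 := by
  rw [qvec, HPmat_some]
  rcases paleyRow_eq_one_or 1 (Or.inl rfl) a j with h | h <;> rw [h] <;> cases s <;> decide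

theorem qvec_eq_zero_or_one (s : Bool) (a : F) (j : Option F) :
    qvec F s a j = 0 ∨ qvec F s a j = 1 := by
  rw [qvec, HPmat_some]
  rcases paleyRow_eq_one_or 1 (Or.inl rfl) a j with h | h <;> rw [h] <;> cases s <;> decide

theorem qvec_ne_zero_iff (s : Bool) (a : F) (j : Option F) :
    qvec F s a j ≠ 0 ↔ qvec F s a j = 1 := by
  rcases qvec_eq_zero_or_one s a j with h | h <;> simp [h]

theorem one_mem_QRcode (hq : Fintype.card F % 12 = 11) : (1 : Option F → ZMod 3) ∈ QRcode F := by
  have hF := ringChar_ne_two_of_card hq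
  have hcard := natCast_card_eq_two hq
  have : (1 : Option F → ZMod 3) = -∑ a, bRow F a := by
    funext j
    rw [Pi.neg_apply, Finset.sum_apply]
    have h1 : ∑ a, paleyRow 1 a j = (paleyRow 1 (0 : F) j) * 0 + (if j = none then
        (Fintype.card F : ℤ) else -1) := by
      rcases j with _ | b
      · simp [paleyRow]
      · simp [-quadraticChar_apply, paleyRow, Finset.sum_sub_distrib, sum_quadraticChar_sub hF]
    have h2 : ∑ a : F, bRow F a j = -((∑ a, paleyRow 1 a j : ℤ) : ZMod 3) - Fintype.card F := by
      simp [bRow_eq, Finset.sum_sub_distrib]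
    rw [h2, h1, hcard]
    split_ifs <;> push_cast <;> rw [← sub_eq_zero]
    · rw [hcard]; simp; rfl
    · simp; rfl
  rw [this]
  exact neg_mem (sum_mem fun a _ => bRow_mem a)

theorem qvec_mem (hq : Fintype.card F % 12 = 11) (s : Bool) (a : F) : qvec F s a ∈ QRcode F := by
  cases s
  · rw [qvec_false]
    exact bRow_mem a
  · rw [qvec_true]
    exact sub_mem (one_mem_QRcode hq) (bRow_mem a)

theorem bRow_dotProduct_bRow (hq : Fintype.card F % 12 = 11) (a b : F) :
    bRow F a ⬝ᵥ bRow F b = 0 := by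
  have hcard := natCast_card_eq_two hq
  have hprod : ((∑ j, paleyRow 1 a j * paleyRow 1 b j : ℤ) : ZMod 3) = 0 := by
    by_cases h : a = b
    · subst h
      have : (∑ j, paleyRow 1 a j * paleyRow 1 a j) = Fintype.card F + 1 := by
        simp [paleyRow_mul_self 1 (Or.inl rfl)]
      rw [this]
      push_cast
      rw [hcard]
      rfl
    · rw [sum_paleyRow_mul_paleyRow hq h, Int.cast_zero]
  have ha : ((∑ j, paleyRow 1 a j : ℤ) : ZMod 3) = 0 := by rw [sum_paleyRow hq, Int.cast_zero]
  have hb : ((∑ j, paleyRow 1 b j : ℤ) : ZMod 3) = 0 := by rw [sum_paleyRow hq, Int.cast_zero]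
  have h1 : ∑ _j : Option F, (1 : ZMod 3) = 0 := by
    simp only [Finset.sum_const, Finset.card_univ, Fintype.card_option, nsmul_eq_mul]
    push_cast
    rw [hcard]
    rfl
  have : bRow F a ⬝ᵥ bRow F b = ∑ j, (((paleyRow 1 a j : ℤ) : ZMod 3) * (paleyRow 1 b j : ℤ)
      + (paleyRow 1 a j : ℤ) + (paleyRow 1 b j : ℤ) + 1) :=
    Finset.sum_congr rfl fun j _ => by
      rw [bRow_eq, bRow_eq]
      ring
  rw [this, Finset.sum_add_distrib, Finset.sum_add_distrib, Finset.sum_add_distrib, h1]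
  push_cast at hprod ha hb
  rw [hprod, ha, hb]
  simp

/-- The code `QRcode F` is self-orthogonal. -/
theorem dotProduct_eq_zero_of_mem (hq : Fintype.card F % 12 = 11) {c d : Option F → ZMod 3}
    (hc : c ∈ QRcode F) (hd : d ∈ QRcode F) : c ⬝ᵥ d = 0 := by
  induction hc using Submodule.span_induction with
  | zero => simp
  | add x y _ _ hx hy => rw [add_dotProduct, hx, hy, add_zero]
  | smul r x _ hx => rw [smul_dotProduct, hx, smul_zero]
  | mem x hx =>
    obtain ⟨a, rfl⟩ := hx
    induction hd using Submodule.span_induction with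
    | zero => simp
    | add x y _ _ hx hy => rw [dotProduct_add, hx, hy, add_zero]
    | smul r x _ hx => rw [dotProduct_smul, hx, smul_zero]
    | mem x hx =>
      obtain ⟨b, rfl⟩ := hx
      exact bRow_dotProduct_bRow hq a b

theorem comp_map_add_mem (t : F) {c : Option F → ZMod 3} (hc : c ∈ QRcode F) :
    (fun j => c (j.map (· + t))) ∈ QRcode F := by
  refine comp_mem_QRcode (fun j : Option F => j.map (· + t)) (fun a => ?_) hc
  convert bRow_mem (a - t) using 1
  funext j
  rcases j with _ | b
  · simp
  · simp only [Function.comp_apply, Option.map_some, bRow_some]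
    rw [show b + t - a = b - (a - t) by ring]

theorem comp_map_mul_mem {t : F} (ht : quadraticChar F t = 1) {c : Option F → ZMod 3}
    (hc : c ∈ QRcode F) : (fun j => c (j.map (t * ·))) ∈ QRcode F := by
  have ht0 : t ≠ 0 := by
    rintro rfl
    simp at ht
  refine comp_mem_QRcode (fun j : Option F => j.map (t * ·)) (fun a => ?_) hc
  convert bRow_mem (t⁻¹ * a) using 1
  funext j
  rcases j with _ | b
  · simp
  · simp only [Function.comp_apply, Option.map_some, bRow_some]
    rw [show t * b - a = t * (b - t⁻¹ * a) by field_simp, map_mul, ht, one_mul]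

theorem quadraticChar_map {K : Type} [Field K] [Fintype K] [DecidableEq K] (e : F ≃+* K) (x : F) :
    quadraticChar K (e x) = 1 ↔ quadraticChar F x = 1 := by
  by_cases hx : x = 0
  · simp [hx]
  · rw [quadraticChar_one_iff_isSquare hx, quadraticChar_one_iff_isSquare (by simpa using hx)]
    refine ⟨fun ⟨y, hy⟩ => ⟨e.symm y, e.injective ?_⟩, fun ⟨y, hy⟩ => ⟨e y, by rw [hy, map_mul]⟩⟩
    simp [hy]

theorem comp_map_equiv_mem {K : Type} [Field K] [Fintype K] [DecidableEq K] (e : K ≃+* F)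
    {c : Option F → ZMod 3} (hc : c ∈ QRcode F) : (fun j => c (j.map e)) ∈ QRcode K := by
  refine comp_mem_QRcode (fun j : Option K => j.map e) (fun a => ?_) hc
  convert bRow_mem (e.symm a) using 1
  funext j
  rcases j with _ | b
  · simp
  · simp only [Function.comp_apply, Option.map_some, bRow_some]
    rw [show e b - a = e (b - e.symm a) by simp]
    simp only [quadraticChar_map]

end Code

section Design

variable {F : Type} [Field F] [Fintype F] [DecidableEq F]

theorem qvec_injective (hq : Fintype.card F % 12 = 11) {s s' : Bool} {a a' : F}
    (h : qvec F s a = qvec F s' a') : s = s' ∧ a = a' := by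
  have hs : s = s' := by
    have h1 := (qvec_eq_one_iff s a none).symm.trans ((by rw [h] : _ ↔ _).trans
      (qvec_eq_one_iff s' a' none))
    revert h1
    cases s <;> cases s' <;> simp [paleyRow]
  subst hs
  refine ⟨rfl, by_contra fun ha => ?_⟩
  have hrow : ∀ j, paleyRow 1 a j = paleyRow 1 a' j := by
    intro j
    have h1 := (qvec_eq_one_iff s a j).symm.trans ((by rw [h] : _ ↔ _).trans
      (qvec_eq_one_iff s a' j))
    rcases paleyRow_eq_one_or 1 (Or.inl rfl) a j with h2 | h2 <;>
    rcases paleyRow_eq_one_or 1 (Or.inl rfl) a' j with h3 | h3 <;>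
    rw [h2, h3] at h1 ⊢ <;> cases s <;> simp at h1
  have h0 := sum_paleyRow_mul_paleyRow hq ha
  simp only [hrow, paleyRow_mul_self 1 (Or.inl rfl)] at h0
  simp at h0
  omega

theorem card_qvec_ne_zero (hq : Fintype.card F % 12 = 11) (s : Bool) (a : F) :
    (univ.filter fun j => qvec F s a j ≠ 0).card = (Fintype.card F + 1) / 2 := by
  have h : 2 * ((univ.filter fun j => qvec F s a j ≠ 0).card : ℤ) = Fintype.card F + 1 := by
    rw [Finset.card_filter]
    push_cast
    have : ∀ j, (2 * if qvec F s a j ≠ 0 then 1 else 0 : ℤ) =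
        1 + (if s then -1 else 1) * paleyRow 1 a j := by
      intro j
      simp only [qvec_ne_zero_iff, qvec_eq_one_iff]
      rcases paleyRow_eq_one_or 1 (Or.inl rfl) a j with h | h <;> rw [h] <;> cases s <;> simp
    rw [Finset.mul_sum, Finset.sum_congr rfl fun j _ => this j, Finset.sum_add_distrib,
      ← Finset.mul_sum, sum_paleyRow hq]
    simp
  omega

theorem card_qvec_eq_one_triple (hq : Fintype.card F % 12 = 11) {j₁ j₂ j₃ : Option F}
    (h₁₂ : j₁ ≠ j₂) (h₁₃ : j₁ ≠ j₃) (h₂₃ : j₂ ≠ j₃) :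
    (univ.filter fun p : Bool × F => qvec F p.1 p.2 j₁ = 1 ∧ qvec F p.1 p.2 j₂ = 1 ∧
      qvec F p.1 p.2 j₃ = 1).card = (Fintype.card F - 3) / 4 := by
  have h : 4 * ((univ.filter fun p : Bool × F => qvec F p.1 p.2 j₁ = 1 ∧ qvec F p.1 p.2 j₂ = 1 ∧
      qvec F p.1 p.2 j₃ = 1).card : ℤ) = Fintype.card F - 3 := by
    rw [Finset.card_filter, Fintype.sum_prod_type, Fintype.sum_bool, ← Finset.sum_add_distrib]
    push_cast
    have : ∀ a : F, 4 * ((if qvec F true a j₁ = 1 ∧ qvec F true a j₂ = 1 ∧ qvec F true a j₃ = 1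
        then 1 else 0 : ℤ) + (if qvec F false a j₁ = 1 ∧ qvec F false a j₂ = 1 ∧
          qvec F false a j₃ = 1 then 1 else 0 : ℤ)) =
        1 + paleyRow 1 a j₁ * paleyRow 1 a j₂ + paleyRow 1 a j₁ * paleyRow 1 a j₃
          + paleyRow 1 a j₂ * paleyRow 1 a j₃ := by
      intro a
      simp only [qvec_eq_one_iff]
      rcases paleyRow_eq_one_or 1 (Or.inl rfl) a j₁ with h1 | h1 <;>
      rcases paleyRow_eq_one_or 1 (Or.inl rfl) a j₂ with h2 | h2 <;>
      rcases paleyRow_eq_one_or 1 (Or.inl rfl) a j₃ with h3 | h3 <;>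
      rw [h1, h2, h3] <;> simp
    rw [Finset.mul_sum, Finset.sum_congr rfl fun a _ => this a]
    simp only [Finset.sum_add_distrib, sum_paleyRow_mul_of_ne hq 1 (Or.inl rfl) h₁₂,
      sum_paleyRow_mul_of_ne hq 1 (Or.inl rfl) h₁₃, sum_paleyRow_mul_of_ne hq 1 (Or.inl rfl) h₂₃]
    simp
    ring
  omega

end Design

section Halves

variable {F : Type} [Field F] [Fintype F] [DecidableEq F]

/-- The number of nonzero coordinates of `c` at the positions where the row of index `0` of the
Paley matrix with sign `-1` takes the value `e`. These positions are `0` and the squares for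
`e = 1`, and `∞` and the nonsquares for `e = -1`. -/
def halfWeight (e : ℤ) (c : Option F → ZMod 3) : ℕ :=
  (univ.filter fun j => c j ≠ 0 ∧ paleyRow (-1) (0 : F) j = e).card

theorem halfWeight_add_halfWeight (c : Option F → ZMod 3) :
    halfWeight 1 c + halfWeight (-1) c = hammingNorm c := by
  simp only [halfWeight, hammingNorm, Finset.card_filter, ← Finset.sum_add_distrib]
  refine Finset.sum_congr rfl fun j _ => ?_
  rcases paleyRow_eq_one_or (-1) (Or.inr rfl) (0 : F) j with h | h <;> rw [h] <;> simp

theorem sum_paleyRow_mul_indicator (c : Option F → ZMod 3) :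
    ∑ j, paleyRow (-1) (0 : F) j * (if c j ≠ 0 then 1 else 0) =
      (halfWeight 1 c : ℤ) - halfWeight (-1) c := by
  simp only [halfWeight, Finset.card_filter]
  push_cast
  rw [← Finset.sum_sub_distrib]
  refine Finset.sum_congr rfl fun j _ => ?_
  rcases paleyRow_eq_one_or (-1) (Or.inr rfl) (0 : F) j with h | h <;> rw [h] <;>
  by_cases hc : c j = 0 <;> simp [hc]

theorem exists_translate_halfWeight_le (hq : Fintype.card F % 12 = 11) {c : Option F → ZMod 3}
    (hc : c ∈ QRcode F) (k : ℕ)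
    (hk : 2 * k + 2 ≤ hammingNorm c → (Fintype.card F : ℤ) * (hammingNorm c - 2 * k - 2) ^ 2 <
      hammingNorm c * (Fintype.card F + 1 - hammingNorm c)) :
    ∃ d ∈ QRcode F, hammingNorm d = hammingNorm c ∧
      (halfWeight 1 d ≤ k ∨ halfWeight (-1) d ≤ k) := by
  by_contra! hcon
  let s (a : F) : Option F → ZMod 3 := fun j => c (j.map (· + a))
  have hequiv : ∀ a : F, Function.Bijective (Option.map (· + a) : Option F → Option F) :=
    fun a => (Equiv.optionCongr (Equiv.addRight a)).bijective
  have hnorm : ∀ a, hammingNorm (s a) = hammingNorm c := by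
    intro a
    simp only [hammingNorm, Finset.card_filter]
    exact Fintype.sum_bijective _ (hequiv a) _ _ fun _ => rfl
  have hsum : ∀ a, ∑ j, paleyRow (-1) a j * (if c j ≠ 0 then 1 else 0) =
      (halfWeight 1 (s a) : ℤ) - halfWeight (-1) (s a) := by
    intro a
    rw [← sum_paleyRow_mul_indicator]
    refine (Fintype.sum_bijective _ (hequiv a) _ _ fun j => ?_).symm
    congr 1
    rcases j with _ | b
    · rfl
    · simp [-quadraticChar_apply, paleyRow]
  have hbound : ∀ a, (∑ j, paleyRow (-1) a j * (if c j ≠ 0 then 1 else 0)) ^ 2 ≤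
      ((hammingNorm c : ℤ) - 2 * k - 2) ^ 2 := by
    intro a
    rw [hsum]
    obtain ⟨h1, h2⟩ := hcon (s a) (comp_map_add_mem a hc) (hnorm a)
    have h3 := halfWeight_add_halfWeight (s a)
    rw [hnorm] at h3
    apply sq_le_sq'
    · omega
    · omega
  have h2k : 2 * k + 2 ≤ hammingNorm c := by
    obtain ⟨h1, h2⟩ := hcon c hc rfl
    have h3 := halfWeight_add_halfWeight c
    omega
  have hle := Finset.sum_le_sum fun a (_ : a ∈ (univ : Finset F)) => hbound a
  have hwt : ∑ j, (if c j ≠ 0 then 1 else 0 : ℤ) = hammingNorm c := by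
    simp [hammingNorm, Finset.card_filter]
  have hwt2 : ∑ j, (if c j ≠ 0 then 1 else 0 : ℤ) ^ 2 = hammingNorm c := by
    rw [← hwt]
    exact Finset.sum_congr rfl fun j _ => by split_ifs <;> norm_num
  rw [sum_sq_sum_paleyRow_mul hq (-1) (Or.inr rfl), hwt, hwt2, Finset.sum_const,
    Finset.card_univ, nsmul_eq_mul] at hle
  linarith [hk h2k]

end Halves

section Search

/-- The number of the `n` lowest hexadecimal digits of a number that are not divisible by 3. -/
def digitCount (n : ℕ) : ℕ → ℕ :=
  Nat.rec (fun _ => nat_lit 0) (fun _ ih N => Nat.add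
    (Nat.div (Nat.succ (Nat.mod (Nat.mod N (nat_lit 16)) (nat_lit 3))) (nat_lit 2))
    (ih (Nat.div N (nat_lit 16)))) n

theorem digitCount_succ (n N : ℕ) :
    digitCount (n + 1) N = (N % 16 % 3 + 1) / 2 + digitCount n (N / 16) := rfl

/-- Check that adding to `acc` at most one entry from each of at most `b` pairs of the list gives a
number for which `digitCount n` plus the number of added entries is at least `thr + b`. -/
def searchOK (n thr : ℕ) : List (ℕ × ℕ) → ℕ → ℕ → Bool
  | [], b, acc => Nat.ble (Nat.add thr b) (digitCount n acc)
  | _ :: _, 0, acc => Nat.ble thr (digitCount n acc)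
  | (x, y) :: l, b + 1, acc =>
    searchOK n thr l (b + 1) acc &&
      (searchOK n thr l b (Nat.add acc x) && searchOK n thr l b (Nat.add acc y))

/-- The multiple of an entry selected by a scalar of `ZMod 3`. -/
def pick (z : ZMod 3) (x : ℕ × ℕ) : ℕ := if z = 0 then 0 else if z = 1 then x.1 else x.2

theorem searchOK_sound {n thr : ℕ} (u : ℕ → ZMod 3) (P : ℕ → ℕ × ℕ) :
    ∀ (l : List ℕ) (b acc : ℕ), searchOK n thr (l.map P) b acc = true →
      (l.map fun i => if u i = 0 then 0 else 1).sum ≤ b →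
      thr + b ≤ (l.map fun i => if u i = 0 then 0 else 1).sum +
        digitCount n (acc + (l.map fun i => pick (u i) (P i)).sum)
  | [], b, acc, h, _ => by
    simpa [searchOK] using h
  | i :: l, 0, acc, h, hb => by
    have hz : ∀ j ∈ i :: l, u j = 0 := by
      intro j hj
      by_contra hne
      have := List.single_le_sum (l := (i :: l).map fun i => if u i = 0 then 0 else 1)
        (by simp) 1 (List.mem_map.2 ⟨j, hj, by simp [hne]⟩)
      omega
    have hp : ((i :: l).map fun i => pick (u i) (P i)).sum = 0 :=
      List.sum_eq_zero fun x hx => by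
        obtain ⟨j, hj, rfl⟩ := List.mem_map.1 hx
        simp [pick, hz j hj]
    rw [hp]
    have h' : thr ≤ digitCount n acc := by simpa [searchOK] using h
    simp only [add_zero]
    omega
  | i :: l, b + 1, acc, h, hb => by
    simp only [List.map_cons, searchOK, Bool.and_eq_true] at h
    obtain ⟨h0, h1, h2⟩ := h
    simp only [List.map_cons, List.sum_cons] at hb ⊢
    by_cases hi : u i = 0
    · have := searchOK_sound u P l (b + 1) acc h0 (by simpa [hi] using hb)
      simpa [hi, pick] using this
    · simp only [hi, if_false] at hb ⊢
      have hb' : (l.map fun i => if u i = 0 then 0 else 1).sum ≤ b := by omega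
      by_cases hi1 : u i = 1
      · have := searchOK_sound u P l b (acc + (P i).1) h1 hb'
        rw [show pick (u i) (P i) = (P i).1 by simp [pick, hi1], ← add_assoc acc]
        omega
      · have := searchOK_sound u P l b (acc + (P i).2) h2 hb'
        rw [show pick (u i) (P i) = (P i).2 by simp [pick, hi, hi1], ← add_assoc acc]
        omega

/-- The number with hexadecimal digits `f t` for `t` in the list. -/
def packDigits (f : ℕ → ℕ) (l : List ℕ) : ℕ := l.foldr (fun t acc => f t + 16 * acc) 0

theorem packDigits_cons (f : ℕ → ℕ) (t : ℕ) (l : List ℕ) :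
    packDigits f (t :: l) = f t + 16 * packDigits f l := rfl

theorem packDigits_add (f g : ℕ → ℕ) (l : List ℕ) :
    packDigits f l + packDigits g l = packDigits (fun t => f t + g t) l := by
  induction l with
  | nil => rfl
  | cons t l ih =>
    simp only [packDigits_cons, ← ih]
    ring

theorem packDigits_zero (l : List ℕ) : packDigits (fun _ => 0) l = 0 := by
  induction l with
  | nil => rfl
  | cons t l ih => simp [packDigits_cons, ih]

theorem sum_packDigits (g : ℕ → ℕ → ℕ) (l m : List ℕ) :
    (m.map fun i => packDigits (g i) l).sum =
      packDigits (fun t => (m.map fun i => g i t).sum) l := by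
  induction m with
  | nil => simp [packDigits_zero]
  | cons i m ih => simp only [List.map_cons, List.sum_cons, ih, packDigits_add]

theorem digitCount_packDigits (f : ℕ → ℕ) (l : List ℕ) (hf : ∀ t ∈ l, f t < 16) :
    digitCount l.length (packDigits f l) =
      (l.map fun t => if f t % 3 = 0 then 0 else 1).sum := by
  induction l with
  | nil => rfl
  | cons t l ih =>
    have ht := hf t (by simp)
    rw [packDigits_cons, List.length_cons, digitCount_succ, List.map_cons, List.sum_cons,
      show (f t + 16 * packDigits f l) / 16 = packDigits f l by omega,
      show (f t + 16 * packDigits f l) % 16 = f t by omega,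
      ih fun t ht => hf t (List.mem_cons_of_mem _ ht)]
    congr 1
    split_ifs <;> omega

/-- The matrix of a systematic bordered circulant generator of the code, in terms of the border
`(0, 1, 2)` and a table of values at the squares modulo `p`. -/
def entry (p : ℕ) (tab : List ℕ) (i t : ℕ) : ℕ :=
  if i = 0 then (if t = 0 then 0 else 1) else if t = 0 then 2 else tab.getD (i * t % p) 0

/-- The rows other than that of index `1` of the matrix `entry p tab`, and their negatives. -/
def packPairs (p : ℕ) (tab Q : List ℕ) : List (ℕ × ℕ) :=
  (0 :: Q).map fun i => (packDigits (entry p tab i) (0 :: 1 :: Q),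
    packDigits (fun t => 2 * entry p tab i t % 3) (0 :: 1 :: Q))

theorem entry_le_two {p : ℕ} {tab : List ℕ} (htab : ∀ x ∈ tab, x ≤ 2) (i t : ℕ) :
    entry p tab i t ≤ 2 := by
  rw [entry]
  split_ifs
  · simp
  · simp
  · simp
  · rw [List.getD_eq_getElem?_getD]
    rcases h : tab[i * t % p]? with _ | x
    · simp
    · simpa using htab x (List.mem_of_getElem? h)

theorem le_weight_of_searchOK {p k thr : ℕ} {tab Q : List ℕ} (htab : ∀ x ∈ tab, x ≤ 2)
    (hk : k ≤ 6) (hs : searchOK (Q.length + 2) thr (packPairs p tab Q) k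
      (packDigits (entry p tab 1) (0 :: 1 :: Q)) = true)
    (u v : ℕ → ZMod 3) (hu : u 1 = 1)
    (hv : ∀ t ∈ 0 :: 1 :: Q,
      v t = ((0 :: 1 :: Q).map fun i => (entry p tab i t : ZMod 3) * u i).sum)
    (hc : ((0 :: Q).map fun i => if u i = 0 then 0 else 1).sum ≤ k) :
    thr + k ≤ ((0 :: Q).map fun i => if u i = 0 then 0 else 1).sum +
      ((0 :: 1 :: Q).map fun t => if v t = 0 then 0 else 1).sum := by
  have h := searchOK_sound u _ (0 :: Q) k _ hs hc
  let g (i t : ℕ) : ℕ := pick (u i) (entry p tab i t, 2 * entry p tab i t % 3)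
  have hg : ∀ i, pick (u i) (packDigits (entry p tab i) (0 :: 1 :: Q),
      packDigits (fun t => 2 * entry p tab i t % 3) (0 :: 1 :: Q)) =
      packDigits (g i) (0 :: 1 :: Q) := by
    intro i
    simp only [g, pick]
    split_ifs
    · rw [packDigits_zero]
    · rfl
    · rfl
  have hgcast : ∀ i t, (g i t : ZMod 3) = (entry p tab i t : ZMod 3) * u i := by
    intro i t
    have h3 : ∀ z : ZMod 3, z = 0 ∨ z = 1 ∨ z = 2 := by decide
    rcases h3 (u i) with h | h | h
    · simp [g, pick, h]
    · simp [g, pick, h]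
    · have h20 : (2 : ZMod 3) ≠ 0 := by decide
      have h21 : (2 : ZMod 3) ≠ 1 := by decide
      simp only [g, pick, h, h20, h21, if_false, ZMod.natCast_mod]
      push_cast
      ring
  have hgle : ∀ i t, g i t ≤ 2 * if u i = 0 then 0 else 1 := by
    intro i t
    have := entry_le_two (p := p) htab i t
    simp only [g, pick]
    split_ifs <;> omega
  simp only [hg] at h
  rw [sum_packDigits, packDigits_add] at h
  have hsum : ∀ t, ((0 :: Q).map fun i => g i t).sum ≤ 2 * k := by
    intro t
    refine le_trans (List.sum_le_sum fun i _ => hgle i t) ?_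
    rw [List.sum_map_mul_left]
    omega
  have hlen : Q.length + 2 = (0 :: 1 :: Q).length := by simp
  rw [hlen, digitCount_packDigits] at h
  · refine h.trans (Nat.add_le_add_left (List.sum_le_sum fun t ht => ?_) _)
    have hcast : ((entry p tab 1 t + ((0 :: Q).map fun i => g i t).sum : ℕ) : ZMod 3) = v t := by
      rw [hv t ht]
      push_cast
      rw [List.map_map]
      simp only [Function.comp_def, hgcast, List.map_cons, List.sum_cons, hu, mul_one]
      ring
    rw [← hcast]
    simp only [ZMod.natCast_eq_zero_iff, Nat.dvd_iff_mod_eq_zero, le_refl]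
  · intro t _
    have := entry_le_two (p := p) htab 1 t
    have := hsum t
    omega

end Search

section Circulant

variable {p : ℕ} [Fact p.Prime]

/-- The nonzero squares modulo `p`. -/
def squares (p : ℕ) [Fact p.Prime] : Finset (ZMod p) := univ.filter fun x => quadraticChar _ x = 1

theorem mem_squares {x : ZMod p} : x ∈ squares p ↔ quadraticChar (ZMod p) x = 1 := by
  simp [squares]

theorem ne_zero_of_mem_squares {x : ZMod p} (hx : x ∈ squares p) : x ≠ 0 := by
  rintro rfl
  simp [mem_squares] at hx

theorem mul_mem_squares {x y : ZMod p} (hx : x ∈ squares p) (hy : y ∈ squares p) :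
    x * y ∈ squares p := by
  rw [mem_squares] at *
  rw [map_mul, hx, hy, one_mul]

theorem inv_mem_squares {x : ZMod p} (hx : x ∈ squares p) : x⁻¹ ∈ squares p := by
  have h0 := ne_zero_of_mem_squares hx
  rw [mem_squares] at *
  have := congrArg (quadraticChar (ZMod p)) (mul_inv_cancel₀ h0)
  rwa [map_mul, hx, one_mul, map_one] at this

theorem sum_squares_mul {M : Type*} [AddCommMonoid M] {s : ZMod p} (hs : s ∈ squares p)
    (f : ZMod p → M) : ∑ x ∈ squares p, f (s * x) = ∑ x ∈ squares p, f x := by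
  have h0 := ne_zero_of_mem_squares hs
  refine Finset.sum_nbij' (fun x => s * x) (fun x => s⁻¹ * x) ?_ ?_ ?_ ?_ ?_
  · exact fun x hx => mul_mem_squares hs hx
  · exact fun x hx => mul_mem_squares (inv_mem_squares hs) hx
  · intro x _
    simp [h0]
  · intro x _
    simp [h0]
  · exact fun _ _ => rfl

/-- The number of nonzero values of a function at `0` and at the squares. -/
def squareWeight (u : ZMod p → ZMod 3) : ℕ :=
  (if u 0 = 0 then 0 else 1) + ∑ x ∈ squares p, if u x = 0 then 0 else 1

theorem squareWeight_mul {u : ZMod p → ZMod 3} {s : ZMod p} (hs : s ∈ squares p) {a : ZMod 3}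
    (ha : a ≠ 0) : squareWeight (fun x => a * u (s * x)) = squareWeight u := by
  simp only [squareWeight, mul_zero, mul_eq_zero, ha, false_or]
  rw [sum_squares_mul hs fun x => if u x = 0 then 0 else 1]

theorem sum_squares_eq {M : Type*} [AddCommMonoid M] {Q : List ℕ}
    (hnd : ((1 :: Q).map (Nat.cast : ℕ → ZMod p)).Nodup)
    (hQ : squares p = ((1 :: Q).map (Nat.cast : ℕ → ZMod p)).toFinset) (f : ZMod p → M) :
    ∑ x ∈ squares p, f x = ((1 :: Q).map fun i : ℕ => f i).sum := by
  rw [hQ, List.sum_toFinset _ hnd, List.map_map]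
  rfl

/-- The lower bound for the weight of a codeword of a bordered circulant code that follows from a
check of all combinations of at most `k + 1` rows of which one is the row of index `1`. -/
theorem le_squareWeight_add_squareWeight {k thr : ℕ} {tab Q : List ℕ} (htab : ∀ x ∈ tab, x ≤ 2)
    (hnd : ((1 :: Q).map (Nat.cast : ℕ → ZMod p)).Nodup)
    (hQ : squares p = ((1 :: Q).map (Nat.cast : ℕ → ZMod p)).toFinset)
    (hk : k ≤ 6) (hkQ : thr + k ≤ Q.length + 1)
    (hs : searchOK (Q.length + 2) thr (packPairs p tab Q) k
      (packDigits (entry p tab 1) (0 :: 1 :: Q)) = true)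
    {u v : ZMod p → ZMod 3} (hv0 : v 0 = 2 * ∑ x ∈ squares p, u x)
    (hv : ∀ t ∈ squares p, v t = ∑ x ∈ squares p, (tab.getD (t * x).val 0 : ZMod 3) * u x + u 0)
    (hu : squareWeight u ≤ k + 1) (hne : squareWeight u + squareWeight v ≠ 0) :
    thr + k + 1 ≤ squareWeight u + squareWeight v := by
  have hnat : ∀ n ∈ 1 :: Q, (n : ZMod p) ∈ squares p := fun n hn => by
    rw [hQ, List.mem_toFinset]
    exact List.mem_map_of_mem hn
  have hcard : ∑ _x ∈ squares p, 1 = Q.length + 1 := by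
    rw [sum_squares_eq hnd hQ fun _ => 1]
    simp [add_comm]
  by_cases h : ∀ x ∈ squares p, u x = 0
  · have hv0' : v 0 = 0 := by rw [hv0, Finset.sum_eq_zero h, mul_zero]
    have hv' : ∀ t ∈ squares p, v t = u 0 := fun t ht => by
      rw [hv t ht, Finset.sum_eq_zero fun x hx => by rw [h x hx, mul_zero], zero_add]
    have h1 : squareWeight v = if u 0 = 0 then 0 else Q.length + 1 := by
      rw [squareWeight, hv0', Finset.sum_congr rfl fun x hx => by rw [hv' x hx]]
      split_ifs <;> simp_all
    have h2 : squareWeight u = if u 0 = 0 then 0 else 1 := by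
      rw [squareWeight, Finset.sum_congr rfl fun x hx => by rw [h x hx]]
      simp
    rw [h1, h2] at hne ⊢
    split_ifs at hne ⊢
    · simp at hne
    · omega
  · push Not at h
    obtain ⟨s, hs', hus⟩ := h
    have hs0 := ne_zero_of_mem_squares hs'
    have hsi := inv_mem_squares hs'
    have hus2 : u s * u s = 1 := by
      revert hus
      generalize u s = z
      revert z
      decide
    rw [← squareWeight_mul hs' hus] at hu ⊢
    rw [← squareWeight_mul (u := v) hsi hus]
    set u' : ZMod p → ZMod 3 := fun x => u s * u (s * x) with hu'
    set v' : ZMod p → ZMod 3 := fun x => u s * v (s⁻¹ * x) with hv'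
    have hu1 : u' 1 = 1 := by simp [hu', hus2]
    have hv0' : v' 0 = 2 * ∑ x ∈ squares p, u' x := by
      simp only [hu', hv', mul_zero, hv0]
      rw [← Finset.mul_sum, sum_squares_mul hs' u]
      ring
    have hvt : ∀ t ∈ squares p,
        v' t = ∑ x ∈ squares p, (tab.getD (t * x).val 0 : ZMod 3) * u' x + u' 0 := by
      intro t ht
      simp only [hu', hv', mul_zero, hv _ (mul_mem_squares hsi ht)]
      rw [← sum_squares_mul hs', mul_add, Finset.mul_sum]
      congr 1
      refine Finset.sum_congr rfl fun x _ => ?_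
      rw [show s⁻¹ * t * (s * x) = t * x by field_simp]
      ring
    clear_value u' v'
    have hW : ∀ f : ZMod p → ZMod 3, squareWeight f =
        ((0 :: 1 :: Q).map fun t : ℕ => if f t = 0 then 0 else 1).sum := fun f => by
      rw [squareWeight, sum_squares_eq hnd hQ]
      simp
    have hU : squareWeight u' =
        ((0 :: Q).map fun t : ℕ => if u' t = 0 then 0 else 1).sum + 1 := by
      rw [hW]
      simp only [List.map_cons, List.sum_cons, Nat.cast_one, hu1, one_ne_zero, if_false]
      ring
    rw [hU] at hu ⊢
    have := le_weight_of_searchOK htab hk hs (fun n => u' n) (fun n => v' n) (by simpa using hu1)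
      (fun t ht => ?_) (by omega)
    · rw [← hW] at this
      omega
    have hent : ∀ i ∈ 1 :: Q, entry p tab i t =
        if t = 0 then 2 else tab.getD (i * t % p) 0 := by
      intro i hi
      have : i ≠ 0 := by
        rintro rfl
        simpa using ne_zero_of_mem_squares (hnat 0 hi)
      simp [entry, this]
    rw [List.map_cons, List.sum_cons]
    rcases List.mem_cons.1 ht with rfl | ht
    · rw [Nat.cast_zero, hv0', Finset.mul_sum, sum_squares_eq hnd hQ,
        show entry p tab 0 0 = 0 from rfl, Nat.cast_zero, zero_mul, zero_add]
      refine congrArg _ (List.map_congr_left fun i hi => ?_)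
      rw [hent i hi, if_pos rfl, Nat.cast_ofNat]
    · have ht0 : t ≠ 0 := by
        rintro rfl
        simpa using ne_zero_of_mem_squares (hnat 0 ht)
      rw [hvt _ (hnat t ht), sum_squares_eq hnd hQ, add_comm,
        show entry p tab 0 t = 1 by simp [entry, ht0], Nat.cast_one, one_mul, Nat.cast_zero]
      refine congrArg _ (congrArg _ (List.map_congr_left fun i hi => ?_))
      rw [hent i hi, if_neg ht0, ← Nat.cast_mul, ZMod.val_natCast, mul_comm t]

end Circulant

section Generators

variable {p : ℕ} [Fact p.Prime]

theorem neg_mem_squares_iff (hp : p % 12 = 11) {x : ZMod p} :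
    -x ∈ squares p ↔ quadraticChar (ZMod p) x = -1 := by
  rw [mem_squares, quadraticChar_neg_eq (by rwa [ZMod.card]), neg_eq_iff_eq_neg]

/-- The values of a vector at the finite positions, of which `squareWeight` sees those at `0` and
the squares. -/
def squarePart (c : Option (ZMod p) → ZMod 3) (x : ZMod p) : ZMod 3 := c (some x)

/-- The values of a vector at `∞` and at the negatives of the finite positions; `squareWeight` sees
those at `∞` and the nonsquares. -/
def nonsquarePart (c : Option (ZMod p) → ZMod 3) (x : ZMod p) : ZMod 3 :=
  if x = 0 then c none else c (some (-x))

theorem squareWeight_comp_inv (u : ZMod p → ZMod 3) :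
    squareWeight (fun x => u x⁻¹) = squareWeight u := by
  simp only [squareWeight, _root_.inv_zero]
  congr 1
  refine Finset.sum_nbij' (fun x => x⁻¹) (fun x => x⁻¹) ?_ ?_ ?_ ?_ ?_
  · exact fun x hx => inv_mem_squares hx
  · exact fun x hx => inv_mem_squares hx
  · simp
  · simp
  · exact fun _ _ => rfl

theorem halfWeight_one_eq (c : Option (ZMod p) → ZMod 3) :
    halfWeight 1 c = squareWeight (squarePart c) := by
  have h : ∀ x : ZMod p, (if c (some x) ≠ 0 ∧ paleyRow (-1) 0 (some x) = 1 then 1 else 0) =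
      (if x = 0 then if squarePart c 0 = 0 then 0 else 1 else 0) +
        if x ∈ squares p then if squarePart c x = 0 then 0 else 1 else 0 := by
    intro x
    by_cases h0 : x = 0
    · subst h0
      by_cases hc : c (some 0) = 0 <;>
        simp [-quadraticChar_apply, paleyRow, mem_squares, squarePart, hc, MulChar.map_zero]
    · by_cases hc : c (some x) = 0 <;>
        simp [-quadraticChar_apply, paleyRow, mem_squares, squarePart, hc, h0]
  rw [halfWeight, Finset.card_filter, Fintype.sum_option, Finset.sum_congr rfl fun x _ => h x,
    Finset.sum_add_distrib, squareWeight, Finset.sum_ite_eq' univ, ← Finset.sum_filter]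
  simp [paleyRow]

theorem halfWeight_neg_one_eq (hp : p % 12 = 11) (c : Option (ZMod p) → ZMod 3) :
    halfWeight (-1) c = squareWeight (nonsquarePart c) := by
  have h : ∀ x : ZMod p, (if c (some (-x)) ≠ 0 ∧ paleyRow (-1) 0 (some (-x)) = -1 then 1 else 0) =
        if x ∈ squares p then if nonsquarePart c x = 0 then 0 else 1 else 0 := by
    intro x
    by_cases h0 : x = 0
    · subst h0
      simp [-quadraticChar_apply, paleyRow, mem_squares, MulChar.map_zero]
    · by_cases hc : c (some (-x)) = 0 <;>
        simp [-quadraticChar_apply, paleyRow, mem_squares, nonsquarePart, hc, h0,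
          quadraticChar_neg_eq (F := ZMod p) (by rwa [ZMod.card])]
  rw [halfWeight, Finset.card_filter, Fintype.sum_option, ← Equiv.sum_comp (Equiv.neg (ZMod p))]
  simp only [Equiv.neg_apply]
  rw [Finset.sum_congr rfl fun x _ => h x, squareWeight, ← Finset.sum_filter]
  by_cases hc : c none = 0 <;> simp [paleyRow, nonsquarePart, hc]

theorem sum_squares_of_support {T : ZMod p → ZMod 3} (hT : ∀ x ∉ squares p, T x = 0)
    (f : ZMod p → ZMod 3) : ∑ x, T x * f x = ∑ x ∈ squares p, T x * f x :=
  (Finset.sum_subset (Finset.subset_univ _) fun x _ hx => by rw [hT x hx, zero_mul]).symm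

theorem nonsquarePart_eq_of_mem (hp : p % 12 = 11) {T : ZMod p → ZMod 3}
    (hT : ∀ x ∉ squares p, T x = 0)
    {g : Option (ZMod p) → ZMod 3} (hg : g ∈ QRcode (ZMod p)) (hg0 : g none = 0)
    (hgx : ∀ x, g (some x) = -T x + (if x = -1 then 1 else 0) - if x = 0 then 1 else 0)
    {c : Option (ZMod p) → ZMod 3} (hc : c ∈ QRcode (ZMod p)) {t : ZMod p} (ht : t ∈ squares p) :
    nonsquarePart c t⁻¹ = ∑ x ∈ squares p, T (t * x) * squarePart c x + squarePart c 0 := by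
  have hq : Fintype.card (ZMod p) % 12 = 11 := by rwa [ZMod.card]
  have hti := inv_mem_squares ht
  have ht0 := ne_zero_of_mem_squares hti
  have h := dotProduct_eq_zero_of_mem hq hg (comp_map_mul_mem (mem_squares.1 hti) hc)
  simp only [dotProduct, Fintype.sum_option, hg0, hgx, Option.map_some, add_mul, sub_mul,
    Finset.sum_add_distrib, Finset.sum_sub_distrib, neg_mul, Finset.sum_neg_distrib, ite_mul,
    one_mul, zero_mul, Finset.sum_ite_eq', Finset.mem_univ, if_true, mul_zero, mul_neg, mul_one]
    at h
  rw [sum_squares_of_support hT, ← sum_squares_mul ht] at h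
  have h2 : ∀ x, t⁻¹ * (t * x) = x := fun x => by
    rw [← mul_assoc, inv_mul_cancel₀ (ne_zero_of_mem_squares ht), one_mul]
  simp only [h2] at h
  rw [nonsquarePart, if_neg ht0]
  simp only [squarePart]
  linear_combination h

theorem squarePart_eq_of_mem (hp : p % 12 = 11) {T : ZMod p → ZMod 3}
    (hT : ∀ x ∉ squares p, T x = 0)
    {g : Option (ZMod p) → ZMod 3} (hg : g ∈ QRcode (ZMod p)) (hg0 : g none = -1)
    (hgx : ∀ x, g (some x) = -T (-x) + if x = 1 then 1 else 0)
    {c : Option (ZMod p) → ZMod 3} (hc : c ∈ QRcode (ZMod p)) {t : ZMod p} (ht : t ∈ squares p) :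
    squarePart c t⁻¹ = ∑ x ∈ squares p, T (t * x) * nonsquarePart c x + nonsquarePart c 0 := by
  have hq : Fintype.card (ZMod p) % 12 = 11 := by rwa [ZMod.card]
  have hti := inv_mem_squares ht
  have h := dotProduct_eq_zero_of_mem hq hg (comp_map_mul_mem (mem_squares.1 hti) hc)
  rw [dotProduct, Fintype.sum_option, ← Equiv.sum_comp (Equiv.neg (ZMod p))] at h
  have h1 : ∀ x : ZMod p, -x = 1 ↔ x = -1 := fun x => neg_eq_iff_eq_neg
  simp only [Equiv.neg_apply, hg0, hgx, neg_neg, Option.map_some, Option.map_none, add_mul, h1,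
    Finset.sum_add_distrib, neg_mul, Finset.sum_neg_distrib, ite_mul,
    one_mul, zero_mul, Finset.sum_ite_eq', Finset.mem_univ, if_true, mul_neg, mul_one] at h
  rw [sum_squares_of_support hT, ← sum_squares_mul ht] at h
  have h2 : ∀ x, t⁻¹ * (t * x) = x := fun x => by
    rw [← mul_assoc, inv_mul_cancel₀ (ne_zero_of_mem_squares ht), one_mul]
  have h3 : ∑ x ∈ squares p, T (t * x) * nonsquarePart c x =
      ∑ x ∈ squares p, T (t * x) * c (some (-x)) :=
    Finset.sum_congr rfl fun x hx => by rw [nonsquarePart, if_neg (ne_zero_of_mem_squares hx)]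
  simp only [h2] at h
  rw [h3, nonsquarePart, if_pos rfl, squarePart]
  linear_combination h

theorem nonsquarePart_zero_of_mem (hp : p % 12 = 11) {c : Option (ZMod p) → ZMod 3}
    (hc : c ∈ QRcode (ZMod p)) : nonsquarePart c 0 = 2 * ∑ x ∈ squares p, squarePart c x := by
  have hq : Fintype.card (ZMod p) % 12 = 11 := by rwa [ZMod.card]
  have h3 : (3 : ZMod 3) = 0 := rfl
  have h := dotProduct_eq_zero_of_mem hq (bRow_mem 0) hc
  simp only [dotProduct, Fintype.sum_option, bRow_none, bRow_some, sub_zero, ite_mul, one_mul,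
    zero_mul, ← Finset.sum_filter] at h
  rw [nonsquarePart, if_pos rfl]
  simp only [squarePart, squares]
  linear_combination h - (∑ x with quadraticChar (ZMod p) x = 1, c (some x)) * h3

theorem squarePart_zero_of_mem (hp : p % 12 = 11) {c : Option (ZMod p) → ZMod 3}
    (hc : c ∈ QRcode (ZMod p)) : squarePart c 0 = 2 * ∑ x ∈ squares p, nonsquarePart c x := by
  have hq : Fintype.card (ZMod p) % 12 = 11 := by rwa [ZMod.card]
  have h3 : (3 : ZMod 3) = 0 := rfl
  have h := dotProduct_eq_zero_of_mem hq (sub_mem (one_mem_QRcode hq) (bRow_mem 0)) hc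
  rw [dotProduct, Fintype.sum_option, ← Equiv.sum_comp (Equiv.neg (ZMod p))] at h
  have h1 : ∀ x : ZMod p, ((1 : Option (ZMod p) → ZMod 3) - bRow (ZMod p) 0) (some (-x)) *
      c (some (-x)) = (if x = 0 then c (some 0) else 0) +
        if x ∈ squares p then nonsquarePart c x else 0 := by
    intro x
    rw [Pi.sub_apply, Pi.one_apply, bRow_some, sub_zero, quadraticChar_neg_eq hq]
    simp only [mem_squares]
    by_cases hx : x = 0
    · simp [hx]
    · rw [nonsquarePart, if_neg hx, if_neg hx]
      rcases quadraticChar_dichotomy hx with h | h <;> rw [h] <;> simp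
  simp only [Equiv.neg_apply] at h
  rw [Finset.sum_congr rfl fun x _ => h1 x, Finset.sum_add_distrib, ← Finset.sum_filter,
    ← Finset.sum_filter] at h
  simp only [Finset.filter_eq', Finset.mem_univ, if_true, Finset.sum_singleton, Pi.sub_apply,
    Pi.one_apply, bRow_none, sub_self, zero_mul, zero_add, Finset.filter_mem_eq_inter,
    Finset.univ_inter] at h
  rw [squarePart]
  linear_combination h - (∑ x ∈ squares p, nonsquarePart c x) * h3

end Generators

section Certificates

/-- The value at `x` of the combination of rows of the code with coefficients `m`, where `L` is the
list of the nonzero squares. -/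
def rowCombination (p : ℕ) (L m : List ℕ) (x : ℕ) : ℕ :=
  ∑ a ∈ range p, m.getD a 0 * if (x + (p - a)) % p ∈ L then 1 else 0

theorem sum_val_eq_sum_range {p : ℕ} [NeZero p] (f : ℕ → ZMod 3) :
    ∑ a : ZMod p, f a.val = ∑ a ∈ range p, f a := by
  refine Finset.sum_nbij' ZMod.val (Nat.cast : ℕ → ZMod p) ?_ ?_ ?_ ?_ ?_
  · exact fun a _ => Finset.mem_range.2 (ZMod.val_lt a)
  · exact fun _ _ => Finset.mem_univ _
  · exact fun a _ => ZMod.natCast_zmod_val a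
  · exact fun a ha => ZMod.val_cast_of_lt (Finset.mem_range.1 ha)
  · exact fun _ _ => rfl

/-- A list of the nonzero squares modulo `p`, beginning with `1`. -/
structure IsSquareList (p : ℕ) [Fact p.Prime] (Q : List ℕ) : Prop where
  lt : ∀ n ∈ 1 :: Q, n < p
  nodup : (1 :: Q).Nodup
  mem_iff : ∀ x : ZMod p, quadraticChar (ZMod p) x = 1 ↔ x.val ∈ 1 :: Q

namespace IsSquareList

variable {p : ℕ} [Fact p.Prime] {Q : List ℕ}

theorem nodup_map (h : IsSquareList p Q) :
    ((1 :: Q).map (Nat.cast : ℕ → ZMod p)).Nodup :=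
  List.Nodup.map_on (fun x hx y hy hxy => by
    rw [← ZMod.val_cast_of_lt (h.lt x hx), hxy, ZMod.val_cast_of_lt (h.lt y hy)]) h.nodup

theorem squares_eq (h : IsSquareList p Q) :
    squares p = ((1 :: Q).map (Nat.cast : ℕ → ZMod p)).toFinset := by
  ext x
  rw [mem_squares, h.mem_iff, List.mem_toFinset, List.mem_map]
  refine ⟨fun hx => ⟨x.val, hx, ZMod.natCast_zmod_val x⟩, ?_⟩
  rintro ⟨n, hn, rfl⟩
  rwa [ZMod.val_cast_of_lt (h.lt n hn)]

theorem exists_mem_rowCombination (h : IsSquareList p Q) (m : List ℕ) :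
    ∃ g ∈ QRcode (ZMod p),
    g none = ((∑ a ∈ range p, m.getD a 0 : ℕ) : ZMod 3) ∧
      ∀ x, g (some x) = (rowCombination p (1 :: Q) m x.val : ZMod 3) := by
  refine ⟨∑ a : ZMod p, (m.getD a.val 0 : ZMod 3) • bRow (ZMod p) a,
    sum_mem fun a _ => Submodule.smul_mem _ _ (bRow_mem a), ?_, fun x => ?_⟩
  · rw [Finset.sum_apply, Nat.cast_sum, ← sum_val_eq_sum_range]
    exact Finset.sum_congr rfl fun a _ => by simp
  · rw [Finset.sum_apply, rowCombination, Nat.cast_sum, ← sum_val_eq_sum_range (p := p)]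
    refine Finset.sum_congr rfl fun a _ => ?_
    have : (x - a).val = (x.val + (p - a.val)) % p := by
      rw [← ZMod.val_natCast, Nat.cast_add, Nat.cast_sub (ZMod.val_lt a).le]
      simp [sub_eq_add_neg]
    rw [Pi.smul_apply, bRow_some, smul_eq_mul, Nat.cast_mul, Nat.cast_ite,
      Nat.cast_one, Nat.cast_zero]
    simp only [h.mem_iff, this]

theorem getD_eq_zero (h : IsSquareList p Q) {tab : List ℕ}
    (htab : ∀ n < p, n ∈ 1 :: Q ∨ tab.getD n 0 = 0) (x : ZMod p) (hx : x ∉ squares p) :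
    (tab.getD x.val 0 : ZMod 3) = 0 := by
  rw [mem_squares, h.mem_iff] at hx
  rw [(htab _ (ZMod.val_lt x)).resolve_left hx, Nat.cast_zero]

/-- The vector with coordinates the squares and `0` as information set. -/
theorem exists_generator_neg_one (h : IsSquareList p Q) {tab m : List ℕ}
    (h0 : (∑ a ∈ range p, m.getD a 0) % 3 = 0)
    (hm : ∀ n < p, (rowCombination p (1 :: Q) m n + tab.getD n 0) % 3 =
      if n = 0 then 2 else if n = p - 1 then 1 else 0) : ∃ g ∈ QRcode (ZMod p), g none = 0 ∧
      ∀ x, g (some x) = -(tab.getD x.val 0 : ZMod 3) + (if x = -1 then 1 else 0) -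
        if x = 0 then 1 else 0 := by
  obtain ⟨g, hg, hg0, hgx⟩ := h.exists_mem_rowCombination m
  have hp := (Fact.out : p.Prime).one_lt
  refine ⟨g, hg, ?_, fun x => ?_⟩
  · rw [hg0, ← ZMod.natCast_mod, h0, Nat.cast_zero]
  · have h1 := congrArg (Nat.cast : ℕ → ZMod 3) (hm _ (ZMod.val_lt x))
    rw [ZMod.natCast_mod, Nat.cast_add, ← hgx] at h1
    have hval : x.val = p - 1 ↔ x = -1 := by
      have : Fact (1 < p) := ⟨hp⟩
      rw [← (ZMod.val_injective p).eq_iff, ZMod.val_neg_of_ne_zero, ZMod.val_one]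
    have hval0 : x.val = 0 ↔ x = 0 := ZMod.val_eq_zero x
    simp only [hval, hval0] at h1
    have h2 : ((2 : ℕ) : ZMod 3) = -1 := rfl
    by_cases hx : x = 0
    · have h01 : (0 : ZMod p) ≠ -1 := by simp [eq_comm]
      rw [if_pos hx, h2] at h1
      rw [if_pos hx, if_neg (hx ▸ h01)]
      linear_combination h1
    · rw [if_neg hx, Nat.cast_ite] at h1
      rw [if_neg hx]
      push_cast at h1
      linear_combination h1

theorem exists_generator_one (h : IsSquareList p Q) {tab m : List ℕ}
    (h0 : (∑ a ∈ range p, m.getD a 0) % 3 = 2)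
    (hm : ∀ n < p, (rowCombination p (1 :: Q) m n + tab.getD ((p - n) % p) 0) % 3 =
      if n = 1 then 1 else 0) : ∃ g ∈ QRcode (ZMod p), g none = -1 ∧
      ∀ x, g (some x) = -(tab.getD (-x).val 0 : ZMod 3) + if x = 1 then 1 else 0 := by
  obtain ⟨g, hg, hg0, hgx⟩ := h.exists_mem_rowCombination m
  have hp := (Fact.out : p.Prime).one_lt
  refine ⟨g, hg, ?_, fun x => ?_⟩
  · rw [hg0, ← ZMod.natCast_mod, h0]
    rfl
  · have h1 := congrArg (Nat.cast : ℕ → ZMod 3) (hm _ (ZMod.val_lt x))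
    rw [ZMod.natCast_mod, Nat.cast_add, ← hgx, ← ZMod.neg_val'] at h1
    have hval : x.val = 1 ↔ x = 1 := by
      have : Fact (1 < p) := ⟨hp⟩
      rw [← (ZMod.val_injective p).eq_iff, ZMod.val_one]
    simp only [hval, Nat.cast_ite, Nat.cast_one, Nat.cast_zero] at h1
    linear_combination h1

end IsSquareList

end Certificates

section Bound

theorem le_hammingNorm_of_halfWeight {p : ℕ} [Fact p.Prime] (hp : p % 12 = 11) {k thr : ℕ}
    {Q tab₁ m₁ tab₂ m₂ : List ℕ} (h : IsSquareList p Q) (hk : k ≤ 6) (hkQ : thr + k ≤ Q.length + 1)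
    (htab₁ : ∀ x ∈ tab₁, x ≤ 2) (hQ₁ : ∀ n < p, n ∈ 1 :: Q ∨ tab₁.getD n 0 = 0)
    (h₁ : (∑ a ∈ range p, m₁.getD a 0) % 3 = 0)
    (hm₁ : ∀ n < p, (rowCombination p (1 :: Q) m₁ n + tab₁.getD n 0) % 3 =
      if n = 0 then 2 else if n = p - 1 then 1 else 0)
    (hs₁ : searchOK (Q.length + 2) thr (packPairs p tab₁ Q) k
      (packDigits (entry p tab₁ 1) (0 :: 1 :: Q)) = true)
    (htab₂ : ∀ x ∈ tab₂, x ≤ 2) (hQ₂ : ∀ n < p, n ∈ 1 :: Q ∨ tab₂.getD n 0 = 0)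
    (h₂ : (∑ a ∈ range p, m₂.getD a 0) % 3 = 2)
    (hm₂ : ∀ n < p, (rowCombination p (1 :: Q) m₂ n + tab₂.getD ((p - n) % p) 0) % 3 =
      if n = 1 then 1 else 0)
    (hs₂ : searchOK (Q.length + 2) thr (packPairs p tab₂ Q) k
      (packDigits (entry p tab₂ 1) (0 :: 1 :: Q)) = true)
    {c : Option (ZMod p) → ZMod 3} (hc : c ∈ QRcode (ZMod p)) (hc0 : c ≠ 0)
    (hw : halfWeight 1 c ≤ k + 1 ∨ halfWeight (-1) c ≤ k + 1) :
    thr + k + 1 ≤ hammingNorm c := by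
  have hne : halfWeight 1 c + halfWeight (-1) c ≠ 0 := by
    rw [halfWeight_add_halfWeight]
    exact hammingNorm_ne_zero_iff.2 hc0
  rw [← halfWeight_add_halfWeight]
  rw [halfWeight_one_eq, halfWeight_neg_one_eq hp] at *
  rcases hw with hw | hw
  · obtain ⟨g, hg, hg0, hgx⟩ := h.exists_generator_neg_one h₁ hm₁
    rw [← squareWeight_comp_inv (nonsquarePart c)] at hne ⊢
    refine le_squareWeight_add_squareWeight htab₁ h.nodup_map h.squares_eq hk hkQ hs₁ ?_ ?_ hw hne
    · rw [_root_.inv_zero, nonsquarePart_zero_of_mem hp hc]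
    · exact fun t ht => nonsquarePart_eq_of_mem (T := fun x => (tab₁.getD x.val 0 : ZMod 3)) hp
        (h.getD_eq_zero hQ₁) hg hg0 hgx hc ht
  · obtain ⟨g, hg, hg0, hgx⟩ := h.exists_generator_one h₂ hm₂
    rw [add_comm (squareWeight (squarePart c)), ← squareWeight_comp_inv (squarePart c)] at hne ⊢
    refine le_squareWeight_add_squareWeight htab₂ h.nodup_map h.squares_eq hk hkQ hs₂ ?_ ?_ hw hne
    · rw [_root_.inv_zero, squarePart_zero_of_mem hp hc]
    · exact fun t ht => squarePart_eq_of_mem (T := fun x => (tab₂.getD x.val 0 : ZMod 3)) hp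
        (h.getD_eq_zero hQ₂) hg hg0 hgx hc ht

end Bound

section Tables

instance fact_prime_twentyThree : Fact (Nat.Prime 23) := ⟨by norm_num⟩

instance fact_prime_fortySeven : Fact (Nat.Prime 47) := ⟨by norm_num⟩

/-- The squares modulo 23 other than `0` and `1`. -/
def squareList23 : List ℕ :=
  [2, 3, 4, 6, 8, 9, 12, 13, 16, 18]

/-- Values of the codeword of `QRcode (ZMod 23)` that has a single nonzero value at the positions of
the same kind as `-1`, up to the sign of the values and the argument. -/
def tableNegOne23 : List ℕ :=
  [0, 2, 0, 2, 0, 0, 1, 0, 1, 2, 0, 0, 0, 2, 0, 0, 0, 0, 2, 0, 0, 0, 0]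

/-- Coefficients of the codeword with the values `tableNegOne23`. -/
def coeffNegOne23 : List ℕ :=
  [0, 2, 2, 2, 0, 1, 1, 1]

/-- Values of the codeword of `QRcode (ZMod 23)` that has a single nonzero value at the positions of
the same kind as `1`, up to the sign of the values and the argument. -/
def tableOne23 : List ℕ :=
  [0, 1, 0, 2, 2, 0, 0, 0, 1, 1, 0, 0, 0, 0, 0, 0, 1, 0, 1, 0, 0, 0, 0]

/-- Coefficients of the codeword with the values `tableOne23`. -/
def coeffOne23 : List ℕ :=
  [1, 0, 1, 2, 1, 0, 2, 1, 0, 1, 1, 1]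

theorem isSquareList_squareList23 : IsSquareList 23 squareList23 where
  lt := by decide
  nodup := by decide
  mem_iff x := by
    have h : ∀ x : ZMod 23, (x ≠ 0 ∧ ∃ y, x = y * y) ↔ x.val ∈ 1 :: squareList23 := by
      decide +kernel
    rw [← h]
    by_cases hx : x = 0
    · simp [hx, MulChar.map_zero]
    · rw [quadraticChar_one_iff_isSquare hx]
      exact ⟨fun h => ⟨hx, h⟩, fun h => h.2⟩

theorem searchOK_tableNegOne23 : searchOK 12 6 (packPairs 23 tableNegOne23 squareList23) 0
    (packDigits (entry 23 tableNegOne23 1) (0 :: 1 :: squareList23)) = true := by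
  decide +kernel

theorem searchOK_tableOne23 : searchOK 12 6 (packPairs 23 tableOne23 squareList23) 0
    (packDigits (entry 23 tableOne23 1) (0 :: 1 :: squareList23)) = true := by
  decide +kernel

/-- The squares modulo 47 other than `0` and `1`. -/
def squareList47 : List ℕ :=
  [2, 3, 4, 6, 7, 8, 9, 12, 14, 16, 17, 18, 21, 24, 25, 27, 28, 32, 34, 36, 37, 42]

/-- Values of the codeword of `QRcode (ZMod 47)` that has a single nonzero value at the positions of
the same kind as `-1`, up to the sign of the values and the argument. -/
def tableNegOne47 : List ℕ :=
  [0, 2, 2, 1, 2, 0, 0, 1, 2, 2, 0, 0, 2, 0, 1, 0, 1, 2, 2, 0, 0, 1, 0, 0, 0, 0, 0, 1, 2, 0, 0, 0,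
   0, 0, 1, 0, 2, 2, 0, 0, 0, 0, 1, 0, 0, 0, 0]

/-- Coefficients of the codeword with the values `tableNegOne47`. -/
def coeffNegOne47 : List ℕ :=
  [1, 1, 0, 0, 1, 0, 2, 0, 0, 2, 0, 1, 2, 1, 2, 2, 1, 1, 0, 1, 1, 0, 2]

/-- Values of the codeword of `QRcode (ZMod 47)` that has a single nonzero value at the positions of
the same kind as `1`, up to the sign of the values and the argument. -/
def tableOne47 : List ℕ :=
  [0, 1, 0, 2, 1, 0, 1, 2, 0, 2, 0, 0, 1, 0, 1, 0, 2, 1, 2, 0, 0, 1, 0, 0, 1, 0, 0, 2, 2, 0, 0, 0,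
   0, 0, 1, 0, 1, 2, 0, 0, 0, 0, 1, 0, 0, 0, 0]

/-- Coefficients of the codeword with the values `tableOne47`. -/
def coeffOne47 : List ℕ :=
  [0, 0, 0, 1, 0, 0, 2, 0, 1, 0, 1, 0, 0, 1, 0, 0, 2, 2, 0, 1, 1, 0, 0, 2]

theorem isSquareList_squareList47 : IsSquareList 47 squareList47 where
  lt := by decide
  nodup := by decide
  mem_iff x := by
    have h : ∀ x : ZMod 47, (x ≠ 0 ∧ ∃ y, x = y * y) ↔ x.val ∈ 1 :: squareList47 := by
      decide +kernel
    rw [← h]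
    by_cases hx : x = 0
    · simp [hx, MulChar.map_zero]
    · rw [quadraticChar_one_iff_isSquare hx]
      exact ⟨fun h => ⟨hx, h⟩, fun h => h.2⟩

theorem searchOK_tableNegOne47 : searchOK 24 9 (packPairs 47 tableNegOne47 squareList47) 3
    (packDigits (entry 47 tableNegOne47 1) (0 :: 1 :: squareList47)) = true := by
  have h : packPairs 47 tableNegOne47 squareList47 =
      [(5281877500950955839569596688, 10563755001901911679139193376),
       (10214375126366260203475829282, 5573228937145052132130488593),
       (640891576974724926558838802, 349460450994814778734612513),
       (5281882206091188898982076962, 10563750241407935598907494673),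
       (10253056047445023498180764162, 5592576455191671032255615233),
       (9943576036686255992618488082, 4973601436472048313989931553),
       (5263748650770791193485771042, 10523855412740574111952011793),
       (10541843221416873060941828642, 5299935830385969527932395793),
       (5300086963479302546751889442, 10541918758455956570609094673),
       (638318165171924325906911762, 348180415206358250633109793),
       (5610700879369513759292923922, 10234917401030162130469457953),
       (10562461071170472544372334882, 5283157261110671052647830033),
       (10563749965935677817880580642, 5281882536916292499289415953),
       (9944699683361685611625976082, 4972463622927698091919352353),
       (5302429554636214945889518082, 10543202948215807941730697473),
       (4973677271186099548415074562, 9943500202202679987561042433),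
       (619130619379600466914644242, 309565309804642127036162593),
       (10544327166442502290152759842, 5301291169093846636018340113),
       (10523855726262865673039454722, 5263748337248496333863653633),
       (10563678853742073993877332242, 5281952763667074469194764833),
       (10234770732130242308568322082, 5610634211687731928306425873),
       (4973681973813341466173448482, 9943495444019085843068228113),
       (350749067902028614002082322, 639602078082556769323843873)] := by
    decide +kernel
  have h1 : packDigits (entry 47 tableNegOne47 1) (0 :: 1 :: squareList47) =
      5610634468794011499981050402 := by
    decide +kernel
  rw [h, h1]
  decide +kernel

theorem searchOK_tableOne47 : searchOK 24 9 (packPairs 47 tableOne47 squareList47) 3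
    (packDigits (entry 47 tableOne47 1) (0 :: 1 :: squareList47)) = true := by
  have h : packPairs 47 tableOne47 squareList47 =
      [(5281877500950955839569596688, 10563755001901911679139193376),
       (10523784890761103575692087554, 5263819172750208966072476161),
       (328837599862960833184211234, 657660977056557242420171281),
       (10562470202308772533395132434, 5283162297071819671805698081),
       (5302433981778197357387653394, 10543198520857599971560657441),
       (5283081705552241694554067234, 10562536630186821991356506641),
       (10234846879136558967872819714, 5610785623716308331792441601),
       (330117068261211631360483874, 660234077723373751160148241),
       (5299940571199462548804014354, 10541838480603383338601947681),
       (5281806371459009560304554514, 10563598572358961365955715361),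
       (5592567008292755415895183394, 10253051324001898980054278161),
       (10543198206250240173311856914, 5302434237803630610394260001),
       (4991735618918958070242484514, 9925441854253701460127650321),
       (4973601693718239567503565074, 9943575724316849725016969761),
       (5301296167080626636330107154, 10544336335771343680890208801),
       (9943495461317130540864840194, 4973682011854684564625690881),
       (5261401321110732244843041314, 10522575964941785874535948561),
       (4972463326626837391552422434, 9944699979662493535437918481),
       (10544412170264752411739488514, 5301220332588111602275975681),
       (10215579033586153354306846994, 5572024144481496219799126561),
       (657735965381263313630007314, 328988403144481480706695201),
       (10253051288180547850427568674, 5592566992002955257221030161),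
       (621544042647311830060499474, 310779549439490176587989281)] := by
    decide +kernel
  have h1 : packDigits (entry 47 tableOne47 1) (0 :: 1 :: squareList47) =
      5591291951980740165116174354 := by
    decide +kernel
  rw [h, h1]
  decide +kernel

end Tables

section LowWeight

theorem le_hammingNorm_of_halfWeight_le_23 {c : Option (ZMod 23) → ZMod 3}
    (hc : c ∈ QRcode (ZMod 23)) (hc0 : c ≠ 0) (hw : halfWeight 1 c ≤ 1 ∨ halfWeight (-1) c ≤ 1) :
    7 ≤ hammingNorm c :=
  le_hammingNorm_of_halfWeight (by norm_num) (k := 0) (thr := 6) (m₁ := coeffNegOne23)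
    (m₂ := coeffOne23) isSquareList_squareList23 (by norm_num) (by decide) (by decide)
    (by decide +kernel) (by decide +kernel) (by decide +kernel) searchOK_tableNegOne23 (by decide)
    (by decide +kernel) (by decide +kernel) (by decide +kernel) searchOK_tableOne23 hc hc0 hw

theorem le_hammingNorm_of_halfWeight_le_47 {c : Option (ZMod 47) → ZMod 3}
    (hc : c ∈ QRcode (ZMod 47)) (hc0 : c ≠ 0) (hw : halfWeight 1 c ≤ 4 ∨ halfWeight (-1) c ≤ 4) :
    13 ≤ hammingNorm c :=
  le_hammingNorm_of_halfWeight (by norm_num) (k := 3) (thr := 9) (m₁ := coeffNegOne47)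
    (m₂ := coeffOne47) isSquareList_squareList47 (by norm_num) (by decide) (by decide)
    (by decide +kernel) (by decide +kernel) (by decide +kernel) searchOK_tableNegOne47 (by decide)
    (by decide +kernel) (by decide +kernel) (by decide +kernel) searchOK_tableOne47 hc hc0 hw

theorem hammingNorm_comp_equiv {ι κ : Type*} [Fintype ι] [Fintype κ] (e : ι ≃ κ)
    (c : κ → ZMod 3) : hammingNorm (c ∘ e) = hammingNorm c := by
  simp only [hammingNorm, Finset.card_filter, Function.comp_apply]
  exact Equiv.sum_comp e fun j => if c j ≠ 0 then 1 else 0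

variable {F : Type} [Field F] [Fintype F] [DecidableEq F]

/-- The weights of the nonzero codewords over a prime field, if they are at least `d`, are so over
every field of the same order. -/
theorem le_hammingNorm_of_zmod {p : ℕ} [Fact p.Prime] (hF : Fintype.card F = p) {d : ℕ}
    (h : ∀ c ∈ QRcode (ZMod p), c ≠ 0 → d ≤ hammingNorm c) {c : Option F → ZMod 3}
    (hc : c ∈ QRcode F) (hc0 : c ≠ 0) : d ≤ hammingNorm c := by
  have e : ZMod p ≃+* F := ZMod.ringEquivOfPrime F Fact.out hF
  have hce := hammingNorm_comp_equiv (Equiv.optionCongr e.toEquiv) c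
  rw [← hce]
  refine h _ (comp_map_equiv_mem e hc) ?_
  exact hammingNorm_ne_zero_iff.1 (hce ▸ hammingNorm_ne_zero_iff.2 hc0)

theorem seven_le_hammingNorm_of_mem (hF : Fintype.card F = 23) {c : Option F → ZMod 3}
    (hc : c ∈ QRcode F) (hc0 : c ≠ 0) : 7 ≤ hammingNorm c := by
  refine le_hammingNorm_of_zmod hF (fun c hc hc0 => ?_) hc hc0
  by_contra! hlt
  have h0 := hammingNorm_pos_iff.2 hc0
  obtain ⟨d, hd, hdc, hw⟩ := exists_translate_halfWeight_le (by rw [ZMod.card]) hc 1 fun h => by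
    rw [ZMod.card]
    interval_cases hammingNorm c <;> norm_num at h ⊢
  rw [← hdc] at h0 hlt
  exact absurd (le_hammingNorm_of_halfWeight_le_23 hd (hammingNorm_pos_iff.1 h0) hw) (by omega)

theorem thirteen_le_hammingNorm_of_mem (hF : Fintype.card F = 47) {c : Option F → ZMod 3}
    (hc : c ∈ QRcode F) (hc0 : c ≠ 0) : 13 ≤ hammingNorm c := by
  refine le_hammingNorm_of_zmod hF (fun c hc hc0 => ?_) hc hc0
  by_contra! hlt
  have h0 := hammingNorm_pos_iff.2 hc0
  obtain ⟨d, hd, hdc, hw⟩ := exists_translate_halfWeight_le (by rw [ZMod.card]) hc 4 fun h => by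
    rw [ZMod.card]
    interval_cases hammingNorm c <;> norm_num at h ⊢
  rw [← hdc] at h0 hlt
  exact absurd (le_hammingNorm_of_halfWeight_le_47 hd (hammingNorm_pos_iff.1 h0) hw) (by omega)

end LowWeight

section Extremal

variable {ι : Type*} [Fintype ι] {C : Submodule (ZMod 3) (ι → ZMod 3)}

theorem finrank_eq_and_mem_of_forall_dotProduct_eq_zero
    (hself : ∀ c ∈ C, ∀ d ∈ C, c ⬝ᵥ d = 0)
    (hdim : Fintype.card ι ≤ 2 * Module.finrank (ZMod 3) C) :
    2 * Module.finrank (ZMod 3) C = Fintype.card ι ∧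
      ∀ w : ι → ZMod 3, (∀ c ∈ C, c ⬝ᵥ w = 0) → w ∈ C := by
  let B : LinearMap.BilinForm (ZMod 3) (ι → ZMod 3) := dotProductBilin (ZMod 3) (ZMod 3)
  have hB : B.Nondegenerate := by
    constructor
    · intro x hx
      exact dotProduct_eq_zero x fun w => hx w
    · intro x hx
      exact dotProduct_eq_zero x fun w => by rw [dotProduct_comm]; exact hx w
  have hle : C ≤ B.orthogonal C := fun d hd c hc => hself c hc d hd
  have hfin := LinearMap.BilinForm.finrank_orthogonal hB C
  rw [Module.finrank_fintype_fun_eq_card] at hfin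
  have hmono := Submodule.finrank_mono hle
  have hCle : Module.finrank (ZMod 3) C ≤ Fintype.card ι := by
    simpa using Submodule.finrank_le C
  have heq : C = B.orthogonal C := Submodule.eq_of_le_of_finrank_eq hle (by omega)
  refine ⟨by omega, fun w hw => ?_⟩
  rw [heq]
  exact fun c hc => hw c hc

theorem card_forall_ne_zero [DecidableEq ι] [Fintype C] {d : ℕ}
    (hdual : ∀ w : ι → ZMod 3, (∀ c ∈ C, c ⬝ᵥ w = 0) → w ∈ C)
    (hmin : ∀ c ∈ C, c ≠ 0 → d ≤ hammingNorm c) (J : Finset ι) (hJ : #J < d) :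
    3 ^ #J * #{c : C | ∀ i ∈ J, c.1 i ≠ 0} = 2 ^ #J * Fintype.card C := by
  let ρ : C →ₗ[ZMod 3] (J → ZMod 3) :=
    (LinearMap.funLeft (ZMod 3) (ZMod 3) (Subtype.val : J → ι)).domRestrict C
  have hρ (c : C) (i : J) : ρ c i = c.1 i := rfl
  have hsurj : Function.Surjective ρ := by
    rw [← LinearMap.range_eq_top]
    by_contra hne
    obtain ⟨f, hf0, hf⟩ := Submodule.exists_le_ker_of_lt_top _ (lt_top_iff_ne_top.2 hne)
    let w : ι → ZMod 3 := fun i => if h : i ∈ J then f (Pi.single ⟨i, h⟩ 1) else 0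
    have hfw (y : J → ZMod 3) : f y = ∑ i : J, y i * w i := by
      conv_lhs => rw [pi_eq_sum_univ' y]
      simp [w]
    have hwC : w ∈ C := hdual w fun c hc => by
      have h0 : f (ρ ⟨c, hc⟩) = 0 := hf ⟨_, rfl⟩
      rw [hfw] at h0
      refine Eq.trans ?_ h0
      simp only [hρ]
      rw [Finset.sum_coe_sort J fun i => c i * w i]
      refine (Finset.sum_subset (Finset.subset_univ J) fun i _ hi => ?_).symm
      simp [w, hi]
    have hw0 : w = 0 := by
      by_contra hw0
      have hle := hmin w hwC hw0
      have : hammingNorm w ≤ #J := Finset.card_le_card fun i hi => by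
        by_contra hiJ
        exact (Finset.mem_filter.1 hi).2 (by simp [w, hiJ])
      omega
    exact hf0 (LinearMap.ext fun y => by simp [hfw, hw0])
  have hfib (y : J → ZMod 3) : #{c : C | ρ c = y} = #{c : C | ρ c = 0} :=
    AddMonoidHom.card_fiber_eq_of_mem_range ρ.toAddMonoidHom (hsurj y) (hsurj 0)
  have hcount (T : Finset (J → ZMod 3)) : #{c : C | ρ c ∈ T} = #T * #{c : C | ρ c = 0} := by
    rw [Finset.card_eq_sum_card_fiberwise (f := ρ) (t := T) (fun c hc => by simpa using hc)]
    rw [← smul_eq_mul, ← Finset.sum_const]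
    refine Finset.sum_congr rfl fun y hy => ?_
    rw [← hfib y]
    congr 1
    ext c
    simp only [Finset.mem_filter, Finset.mem_univ, true_and]
    exact ⟨fun h => h.2, fun h => ⟨h ▸ hy, h⟩⟩
  have hall := hcount Finset.univ
  have hne := hcount (Fintype.piFinset fun _ => {0}ᶜ)
  simp only [Finset.mem_univ, Finset.filter_true, Finset.card_univ, Fintype.card_fun,
    ZMod.card, Fintype.card_coe] at hall
  simp only [Fintype.mem_piFinset, Finset.mem_compl, Finset.mem_singleton, hρ,
    Fintype.card_piFinset, Finset.card_compl, ZMod.card, Finset.card_singleton,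
    Finset.prod_const, Finset.card_univ, Fintype.card_coe, Subtype.forall] at hne
  rw [hall, hne]
  ring

theorem sum_choose_hammingNorm [DecidableEq ι] [Fintype C] {d : ℕ}
    (hdual : ∀ w : ι → ZMod 3, (∀ c ∈ C, c ⬝ᵥ w = 0) → w ∈ C)
    (hmin : ∀ c ∈ C, c ≠ 0 → d ≤ hammingNorm c) {j : ℕ} (hj : j < d) :
    3 ^ j * ∑ c : C, (hammingNorm c.1).choose j =
      (Fintype.card ι).choose j * (2 ^ j * Fintype.card C) := by
  have h (c : C) : (hammingNorm c.1).choose j =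
      #{J ∈ powersetCard j (univ : Finset ι) | ∀ i ∈ J, c.1 i ≠ 0} := by
    rw [hammingNorm, ← Finset.card_powersetCard]
    congr 1
    ext J
    simp [Finset.mem_powersetCard, Finset.subset_iff, and_comm]
  simp_rw [h, Finset.card_filter]
  rw [Finset.sum_comm]
  simp_rw [← Finset.card_filter]
  rw [Finset.mul_sum, ← Finset.card_univ (α := ι), ← Finset.card_powersetCard, ← smul_eq_mul,
    ← Finset.sum_const]
  refine Finset.sum_congr rfl fun J hJ => ?_
  rw [Finset.mem_powersetCard] at hJ
  obtain ⟨-, rfl⟩ := hJ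
  exact card_forall_ne_zero hdual hmin J hj

theorem three_dvd_hammingNorm {c : ι → ZMod 3} (h : c ⬝ᵥ c = 0) : 3 ∣ hammingNorm c := by
  rw [← ZMod.natCast_eq_zero_iff, ← h, hammingNorm, Finset.card_filter, dotProduct, Nat.cast_sum]
  refine Finset.sum_congr rfl fun i _ => ?_
  generalize c i = x
  revert x
  decide

/-- The coefficients of an integer valued polynomial, in the basis of the binomial coefficients,
which vanishes at `15, 18, …, 45`. -/
def annihilator : Fin 12 → ℤ :=
  ![-19586258055, 6725292119, -2148281343, 632223579, -169358163, 40664715, -8576685, 1545453,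
    -228501, 26001, -2025, 81]

theorem card_hammingNorm_eq_fortyEight [DecidableEq ι] [Fintype C] (hι : Fintype.card ι = 48)
    (hself : ∀ c ∈ C, ∀ d ∈ C, c ⬝ᵥ d = 0) (hdim : 24 ≤ Module.finrank (ZMod 3) C)
    (hmin : ∀ c ∈ C, c ≠ 0 → 13 ≤ hammingNorm c) :
    #{c : C | hammingNorm c.1 = 48} = 96 := by
  obtain ⟨hfin, hdual⟩ := finrank_eq_and_mem_of_forall_dotProduct_eq_zero hself (by omega)
  have hcard : Fintype.card C = 3 ^ 24 := by
    rw [Module.card_eq_pow_finrank (K := ZMod 3), ZMod.card]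
    congr 1
    omega
  have hmoment (j : Fin 12) : ∑ c : C, ((hammingNorm c.1).choose j : ℤ) =
      (48 : ℕ).choose j * (2 ^ (j : ℕ) * 3 ^ (24 - j : ℕ)) := by
    have h := sum_choose_hammingNorm hdual hmin (j := j) (by omega)
    rw [hι, hcard, ← Nat.sub_add_cancel (show (j : ℕ) ≤ 24 by omega), Nat.sub_add_cancel
      (show (j : ℕ) ≤ 24 by omega), show 3 ^ 24 = 3 ^ (j : ℕ) * 3 ^ (24 - j : ℕ) by
        rw [← pow_add]; congr 1; omega] at h
    have h' : ∑ c : C, (hammingNorm c.1).choose j =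
        (48 : ℕ).choose j * (2 ^ (j : ℕ) * 3 ^ (24 - j : ℕ)) :=
      Nat.eq_of_mul_eq_mul_left (pow_pos (by norm_num : 0 < 3) (j : ℕ)) (by rw [h]; ring)
    exact_mod_cast h'
  have hvalue (c : C) : ∑ j, annihilator j * ((hammingNorm c.1).choose j : ℤ) =
      (if c = 0 then -19586258055 else 0) + if hammingNorm c.1 = 48 then 14348907 else 0 := by
    by_cases hc : c = 0
    · subst hc
      simp only [ZeroMemClass.coe_zero, hammingNorm_zero]
      decide +kernel
    · have hc0 : c.1 ≠ 0 := fun h => hc (Subtype.ext h)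
      have h1 := hmin c.1 c.2 hc0
      have h2 : hammingNorm c.1 ≤ 48 := hι ▸ hammingNorm_le_card_fintype
      have h3 := three_dvd_hammingNorm (hself c.1 c.2 c.1 c.2)
      rw [if_neg hc]
      generalize hammingNorm c.1 = w at *
      interval_cases w <;> first | omega | decide +kernel
  have hsum : ∑ c : C, ∑ j, annihilator j * ((hammingNorm c.1).choose j : ℤ) =
      ∑ j : Fin 12, annihilator j * ((48 : ℕ).choose j * (2 ^ (j : ℕ) * 3 ^ (24 - j : ℕ))) := by
    rw [Finset.sum_comm]
    refine Finset.sum_congr rfl fun j _ => ?_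
    rw [← Finset.mul_sum, hmoment]
  simp only [hvalue] at hsum
  rw [Finset.sum_add_distrib, Finset.sum_ite_eq' Finset.univ (0 : C), ← Finset.sum_filter,
    Finset.sum_const, show (∑ j : Fin 12, annihilator j *
      ((48 : ℕ).choose j * (2 ^ (j : ℕ) * 3 ^ (24 - j : ℕ))) : ℤ) = -18208762983 by
      decide +kernel] at hsum
  simp only [Finset.mem_univ, if_true, nsmul_eq_mul] at hsum
  omega

end Extremal

section Dimension

theorem card_le_finrank_of_exists_single {ι κ : Type*} [Fintype ι] [Fintype κ] [DecidableEq κ]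
    {C : Submodule (ZMod 3) (ι → ZMod 3)} (π : (ι → ZMod 3) →ₗ[ZMod 3] (κ → ZMod 3))
    (h : ∀ k, ∃ c ∈ C, π c = Pi.single k 1) :
    Fintype.card κ ≤ Module.finrank (ZMod 3) C := by
  have htop : C.map π = ⊤ := by
    rw [eq_top_iff, ← (Pi.basisFun (ZMod 3) κ).span_eq, Submodule.span_le]
    rintro _ ⟨k, rfl⟩
    rw [Pi.basisFun_apply]
    exact h k
  have := Submodule.finrank_map_le π C
  rwa [htop, finrank_top, Module.finrank_fintype_fun_eq_card] at this

theorem finrank_QRcode_le {F K : Type} [Field F] [Fintype F] [DecidableEq F] [Field K] [Fintype K]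
    [DecidableEq K] (e : K ≃+* F) :
    Module.finrank (ZMod 3) (QRcode F) ≤ Module.finrank (ZMod 3) (QRcode K) := by
  let φ := LinearEquiv.funCongrLeft (ZMod 3) (ZMod 3) (Equiv.optionCongr e.toEquiv)
  rw [← LinearEquiv.finrank_map_eq φ (QRcode F)]
  refine Submodule.finrank_mono ?_
  rintro _ ⟨c, hc, rfl⟩
  exact comp_map_equiv_mem e hc

theorem IsSquareList.le_finrank {p : ℕ} [Fact p.Prime] {Q : List ℕ} (hp : p % 12 = 11)
    (h : IsSquareList p Q) {tab : List ℕ} (htab : ∀ n < p, n ∈ 1 :: Q ∨ tab.getD n 0 = 0)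
    {g : Option (ZMod p) → ZMod 3} (hg : g ∈ QRcode (ZMod p)) (hg0 : g none = 0)
    (hgx : ∀ x, g (some x) = -(tab.getD x.val 0 : ZMod 3) + (if x = -1 then 1 else 0) -
      if x = 0 then 1 else 0) :
    p - (Q.length + 1) ≤ Module.finrank (ZMod 3) (QRcode (ZMod p)) := by
  let π : (Option (ZMod p) → ZMod 3) →ₗ[ZMod 3] ({x : ZMod p // x ∉ squares p} → ZMod 3) :=
    LinearMap.funLeft (ZMod 3) (ZMod 3) fun x => if x.1 = 0 then none else some x.1
  have hcard : Fintype.card {x : ZMod p // x ∉ squares p} = p - (Q.length + 1) := by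
    rw [Fintype.card_subtype_compl, Fintype.card_coe, ZMod.card, h.squares_eq,
      List.toFinset_card_of_nodup h.nodup_map, List.length_map, List.length_cons]
  rw [← hcard]
  refine card_le_finrank_of_exists_single π ?_
  rintro ⟨u, hu⟩
  by_cases hu0 : u = 0
  · subst hu0
    refine ⟨_, bRow_mem 0, funext fun ⟨x, hx⟩ => ?_⟩
    by_cases hx0 : x = 0
    · subst hx0
      simp [π, LinearMap.funLeft_apply]
    · rw [Pi.single_eq_of_ne (by simpa using hx0)]
      rw [mem_squares] at hx
      simp [π, LinearMap.funLeft_apply, hx0, bRow_some, hx, -quadraticChar_apply]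
  · have ht : quadraticChar (ZMod p) (-u⁻¹) = 1 := by
      rw [← mem_squares, ← inv_inv (-u⁻¹)]
      refine inv_mem_squares ?_
      rw [inv_neg, inv_inv, neg_mem_squares_iff hp]
      rw [mem_squares] at hu
      exact (quadraticChar_dichotomy hu0).resolve_left hu
    refine ⟨_, comp_map_mul_mem ht hg, funext fun ⟨x, hx⟩ => ?_⟩
    by_cases hx0 : x = 0
    · subst hx0
      rw [Pi.single_eq_of_ne (by simpa using Ne.symm hu0)]
      simp [π, LinearMap.funLeft_apply, hg0]
    · have hmem : -u⁻¹ * x ∉ squares p := by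
        rw [mem_squares, map_mul, ht, one_mul, ← mem_squares]
        exact hx
      have hne : -u⁻¹ * x ≠ 0 := by
        simp [hu0, hx0]
      have hiff : -u⁻¹ * x = -1 ↔ x = u := by
        rw [neg_mul, neg_inj, inv_mul_eq_one₀ hu0, eq_comm]
      simp only [π, LinearMap.funLeft_apply, hx0, if_false, Option.map_some, hgx, hne,
        h.getD_eq_zero htab _ hmem, hiff]
      simp [Pi.single_apply]

theorem twentyFour_le_finrank {F : Type} [Field F] [Fintype F] [DecidableEq F]
    (hF : Fintype.card F = 47) : 24 ≤ Module.finrank (ZMod 3) (QRcode F) := by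
  refine le_trans ?_ (finrank_QRcode_le (ZMod.ringEquivOfPrime F Fact.out hF).symm)
  obtain ⟨g, hg, hg0, hgx⟩ := isSquareList_squareList47.exists_generator_neg_one
    (m := coeffNegOne47) (tab := tableNegOne47) (by decide +kernel) (by decide +kernel)
  exact isSquareList_squareList47.le_finrank (by norm_num) (by decide +kernel) hg hg0 hgx

end Dimension

section Uniqueness

/-- The `±1`-vector with the same positions of the entry `1` as `v`. -/
def signVec {ι : Type*} (v : ι → ZMod 3) (j : ι) : ℤ := if v j = 1 then 1 else -1

theorem signVec_cast {ι : Type*} {v : ι → ZMod 3} (hv : ∀ j, v j = 0 ∨ v j = 1) (j : ι) :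
    (signVec v j : ZMod 3) = -v j - 1 := by
  rcases hv j with h | h <;> simp only [signVec, h] <;> decide

theorem sum_signVec {ι : Type*} [Fintype ι] {v : ι → ZMod 3} (hv : ∀ j, v j = 0 ∨ v j = 1) :
    ∑ j, signVec v j = 2 * hammingNorm v - Fintype.card ι := by
  have h (j : ι) : signVec v j = 2 * (if v j ≠ 0 then 1 else 0) - 1 := by
    rcases hv j with h | h <;> simp [signVec, h]
  simp only [h, Finset.sum_sub_distrib, ← Finset.mul_sum, hammingNorm, Finset.card_filter]
  simp

variable {F : Type} [Field F] [Fintype F] [DecidableEq F]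

theorem two_mul_hammingNorm_sub_qvec {v : Option F → ZMod 3} (hv : ∀ j, v j = 0 ∨ v j = 1)
    (s : Bool) (a : F) : 2 * (hammingNorm (v - qvec F s a) : ℤ) = Fintype.card F + 1 -
      (if s then -1 else 1) * ∑ j, paleyRow 1 a j * signVec v j := by
  have h (j : Option F) : 2 * (if (v - qvec F s a) j ≠ 0 then 1 else 0 : ℤ) =
      1 - (if s then -1 else 1) * (paleyRow 1 a j * signVec v j) := by
    have hq := qvec_eq_one_iff s a j
    rcases hv j with hvj | hvj <;> rcases qvec_eq_zero_or_one s a j with hj | hj <;>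
    rcases paleyRow_eq_one_or (e := 1) (Or.inl rfl) a j with hr | hr <;> cases s <;>
    simp [signVec, hvj, hj, hr] at hq ⊢
  rw [hammingNorm, Finset.card_filter, Nat.cast_sum, Finset.mul_sum, Finset.mul_sum]
  push_cast
  rw [Finset.sum_congr rfl fun j _ => h j, Finset.sum_sub_distrib]
  simp

theorem three_dvd_sum_paleyRow_mul_signVec (hq : Fintype.card F % 12 = 11)
    {v : Option F → ZMod 3} (hvC : v ∈ QRcode F) (hv : ∀ j, v j = 0 ∨ v j = 1) (a : F) :
    (3 : ℤ) ∣ ∑ j, paleyRow 1 a j * signVec v j := by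
  have h1 := one_mem_QRcode hq
  have h := dotProduct_eq_zero_of_mem hq (add_mem (bRow_mem a) h1) (add_mem hvC h1)
  refine (ZMod.intCast_zmod_eq_zero_iff_dvd _ 3).1 (Eq.trans ?_ h)
  rw [Int.cast_sum]
  refine Finset.sum_congr rfl fun j _ => ?_
  rw [Int.cast_mul, signVec_cast hv, Pi.add_apply, Pi.add_apply, bRow_eq, Pi.one_apply]
  ring

theorem four_dvd_sum_paleyRow_mul_signVec (hq : Fintype.card F % 12 = 11)
    {v : Option F → ZMod 3} (hv : ∀ j, v j = 0 ∨ v j = 1)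
    (hw : 2 * hammingNorm v = Fintype.card F + 1) (a : F) :
    (4 : ℤ) ∣ ∑ j, paleyRow 1 a j * signVec v j := by
  have h (j : Option F) : (4 : ℤ) ∣ (paleyRow 1 a j + 1) * (signVec v j + 1) := by
    rcases paleyRow_eq_one_or (e := 1) (Or.inl rfl) a j with hr | hr <;>
    by_cases hj : v j = 1 <;> simp [signVec, hr, hj]
  have hsum := Finset.dvd_sum fun j (_ : j ∈ univ) => h j
  have hs := sum_signVec hv
  rw [Fintype.card_option] at hs
  have hp := sum_paleyRow hq a
  simp only [add_mul, mul_add, Finset.sum_add_distrib, one_mul, mul_one, hs, hp] at hsum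
  simp only [Finset.sum_const, Finset.card_univ, Fintype.card_option, nsmul_eq_mul] at hsum
  push_cast at hsum
  omega

theorem exists_eq_qvec_of_lt (hq : Fintype.card F % 12 = 11)
    (hmin : ∀ c ∈ QRcode F, c ≠ 0 → Fintype.card F < 2 * hammingNorm c + 11)
    {v : Option F → ZMod 3} (hvC : v ∈ QRcode F) (hv : ∀ j, v j = 0 ∨ v j = 1)
    (hw : 2 * hammingNorm v = Fintype.card F + 1) : ∃ s a, v = qvec F s a := by
  obtain ⟨a, ha⟩ : ∃ a : F, ∑ j, paleyRow 1 a j * signVec v j ≠ 0 := by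
    by_contra! h0
    have h := sum_sq_sum_paleyRow_mul hq 1 (Or.inl rfl) (signVec v)
    have hsq (j : Option F) : signVec v j ^ 2 = 1 := by
      by_cases hj : v j = 1 <;> simp [signVec, hj]
    rw [sum_signVec hv, Fintype.card_option] at h
    simp only [h0, hsq] at h
    simp only [Finset.sum_const, Finset.card_univ, Fintype.card_option, nsmul_eq_mul] at h
    have hw' : 2 * (hammingNorm v : ℤ) = Fintype.card F + 1 := by exact_mod_cast hw
    rw [hw'] at h
    push_cast at h
    nlinarith
  have h3 := three_dvd_sum_paleyRow_mul_signVec hq hvC hv a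
  have h4 := four_dvd_sum_paleyRow_mul_signVec hq hv hw a
  obtain ⟨s, hs⟩ : ∃ s : Bool, 12 ≤ (if s then -1 else 1) * ∑ j, paleyRow 1 a j * signVec v j := by
    rcases lt_or_gt_of_ne ha with h | h
    · exact ⟨true, by simp only [if_true]; omega⟩
    · exact ⟨false, by simp only [Bool.false_eq_true, if_false]; omega⟩
  refine ⟨s, a, ?_⟩
  by_contra hne
  have h := hmin _ (sub_mem hvC (qvec_mem hq s a)) (sub_ne_zero.2 hne)
  have hd := two_mul_hammingNorm_sub_qvec hv s a
  omega

theorem exists_eq_qvec_of_card_eq_fortySeven (hF : Fintype.card F = 47)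
    {v : Option F → ZMod 3} (hvC : v ∈ QRcode F) (hv : ∀ j, v j = 0 ∨ v j = 1)
    (hw : 2 * hammingNorm v = Fintype.card F + 1) : ∃ s a, v = qvec F s a := by
  classical
  have hq : Fintype.card F % 12 = 11 := by rw [hF]
  have h1 : (1 : Option F → ZMod 3) ∈ QRcode F := one_mem_QRcode hq
  have hι : Fintype.card (Option F) = 48 := by rw [Fintype.card_option, hF]
  have hcard := card_hammingNorm_eq_fortyEight (C := QRcode F) hι
    (fun c hc d hd => dotProduct_eq_zero_of_mem hq hc hd) (twentyFour_le_finrank hF)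
    fun c hc hc0 => thirteen_le_hammingNorm_of_mem hF hc hc0
  have hfull {c : Option F → ZMod 3} (hc : ∀ j, c j ≠ 0) : hammingNorm c = 48 := by
    rw [hammingNorm, Finset.filter_true_of_mem fun j _ => hc j, Finset.card_univ, hι]
  have hadd {u : Option F → ZMod 3} (hu : ∀ j, u j = 0 ∨ u j = 1)
      (huw : 2 * hammingNorm u = Fintype.card F + 1) :
      hammingNorm (u + 1) = 48 ∧ u + 1 ≠ 1 ∧ u + 1 ≠ -1 := by
    refine ⟨hfull fun j => ?_, fun h => ?_, fun h => ?_⟩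
    · rw [Pi.add_apply, Pi.one_apply]
      rcases hu j with h | h <;> rw [h] <;> decide
    · rw [add_eq_right] at h
      rw [h, hammingNorm_zero] at huw
      omega
    · have : hammingNorm u = 48 := hfull fun j => by
        have := congrFun h j
        rw [Pi.add_apply, Pi.neg_apply, Pi.one_apply] at this
        intro h0
        rw [h0] at this
        exact absurd this (by decide)
      omega
  let one : QRcode F := ⟨1, h1⟩
  let W : Finset (QRcode F) :=
    ((univ.filter fun c : QRcode F => hammingNorm c.1 = 48).erase one).erase (-one)
  have hW : #W = 94 := by
    rw [Finset.card_erase_of_mem, Finset.card_erase_of_mem, hcard]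
    · exact Finset.mem_filter.2 ⟨Finset.mem_univ _, hfull fun j => by simp [one]⟩
    · refine Finset.mem_erase.2 ⟨fun h => ?_, Finset.mem_filter.2 ⟨Finset.mem_univ _,
        hfull fun j => by simp [one]⟩⟩
      have : (-1 : ZMod 3) = 1 := congrFun (congrArg Subtype.val h) none
      exact absurd this (by decide)
  have hmemW {u : Option F → ZMod 3} (huC : u ∈ QRcode F) (hu : ∀ j, u j = 0 ∨ u j = 1)
      (huw : 2 * hammingNorm u = Fintype.card F + 1) :
      (⟨u + 1, add_mem huC h1⟩ : QRcode F) ∈ W := by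
    obtain ⟨h48, hne, hne'⟩ := hadd hu huw
    refine Finset.mem_erase.2 ⟨fun h => hne' (congrArg Subtype.val h), Finset.mem_erase.2
      ⟨fun h => hne (congrArg Subtype.val h), Finset.mem_filter.2 ⟨Finset.mem_univ _, h48⟩⟩⟩
  let f : Bool × F → QRcode F := fun p => ⟨qvec F p.1 p.2 + 1, add_mem (qvec_mem hq _ _) h1⟩
  have hf : Function.Injective f := fun p p' h => by
    obtain ⟨h, h'⟩ := qvec_injective hq (add_right_cancel (congrArg Subtype.val h))
    exact Prod.ext h h'
  have himage : univ.image f = W := by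
    refine Finset.eq_of_subset_of_card_le (Finset.image_subset_iff.2 fun p _ => ?_) ?_
    · refine hmemW (qvec_mem hq _ _) (qvec_eq_zero_or_one _ _) ?_
      have : hammingNorm (qvec F p.1 p.2) = (Fintype.card F + 1) / 2 := card_qvec_ne_zero hq _ _
      omega
    · rw [Finset.card_image_of_injective _ hf, hW, Finset.card_univ, Fintype.card_prod, hF,
        Fintype.card_bool]
  have hvW := hmemW hvC hv hw
  rw [← himage] at hvW
  obtain ⟨p, -, hp⟩ := Finset.mem_image.1 hvW
  exact ⟨p.1, p.2, (add_right_cancel (congrArg Subtype.val hp)).symm⟩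

theorem exists_eq_qvec (hF : Fintype.card F = 11 ∨ Fintype.card F = 23 ∨ Fintype.card F = 47)
    {v : Option F → ZMod 3} (hvC : v ∈ QRcode F) (hv : ∀ j, v j = 0 ∨ v j = 1)
    (hw : 2 * hammingNorm v = Fintype.card F + 1) : ∃ s a, v = qvec F s a := by
  rcases hF with hF | hF | hF
  · refine exists_eq_qvec_of_lt (by rw [hF]) (fun c _ hc0 => ?_) hvC hv hw
    have := hammingNorm_pos_iff.2 hc0
    omega
  · refine exists_eq_qvec_of_lt (by rw [hF]) (fun c hc hc0 => ?_) hvC hv hw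
    have := seven_le_hammingNorm_of_mem hF hc hc0
    omega
  · exact exists_eq_qvec_of_card_eq_fortySeven hF hvC hv hw

end Uniqueness

section Automorphism

theorem comp_symm_mem {ι : Type*} [Fintype ι] {C : Submodule (ZMod 3) (ι → ZMod 3)}
    {σ : Equiv.Perm ι} (h : ∀ c ∈ C, c ∘ σ ∈ C) {c : ι → ZMod 3} (hc : c ∈ C) :
    c ∘ σ.symm ∈ C := by
  let φ := LinearEquiv.funCongrLeft (ZMod 3) (ZMod 3) σ
  have hle : C.map (φ : (ι → ZMod 3) →ₗ[ZMod 3] (ι → ZMod 3)) ≤ C := by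
    rintro _ ⟨d, hd, rfl⟩
    exact h d hd
  rw [← Submodule.eq_of_le_of_finrank_eq hle (LinearEquiv.finrank_map_eq φ C)] at hc
  obtain ⟨d, hd, rfl⟩ := hc
  have hd' : φ d ∘ σ.symm = d := funext fun j => congrArg d (σ.apply_symm_apply j)
  exact hd'.symm ▸ hd

variable {F : Type} [Field F] [Fintype F] [DecidableEq F]

theorem two_mul_hammingNorm_qvec (hq : Fintype.card F % 12 = 11) (s : Bool) (a : F) :
    2 * hammingNorm (qvec F s a) = Fintype.card F + 1 := by
  have : hammingNorm (qvec F s a) = (Fintype.card F + 1) / 2 := card_qvec_ne_zero hq s a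
  omega

theorem forall_comp_mem_QRcode_iff
    (hF : Fintype.card F = 11 ∨ Fintype.card F = 23 ∨ Fintype.card F = 47)
    (σ : Equiv.Perm (Option F)) :
    (∀ c ∈ QRcode F, c ∘ σ ∈ QRcode F) ↔ ∀ s a, ∃ s' a',
      σ '' {j | qvec F s a j ≠ 0} = {j | qvec F s' a' j ≠ 0} := by
  have hq : Fintype.card F % 12 = 11 := by rcases hF with h | h | h <;> rw [h]
  constructor
  · intro h s a
    obtain ⟨s', a', hv⟩ := exists_eq_qvec hF (comp_symm_mem h (qvec_mem hq s a))
      (fun j => qvec_eq_zero_or_one s a (σ.symm j))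
      (by rw [hammingNorm_comp_equiv, two_mul_hammingNorm_qvec hq])
    refine ⟨s', a', ?_⟩
    rw [← hv, Equiv.image_eq_preimage_symm]
    rfl
  · intro h
    suffices h' : ∀ c ∈ QRcode F, c ∘ σ.symm ∈ QRcode F from fun c hc => comp_symm_mem h' hc
    refine fun c hc => comp_mem_QRcode σ.symm (fun a => ?_) hc
    obtain ⟨s', a', hs⟩ := h false a
    rw [← qvec_false]
    convert qvec_mem hq s' a' using 1
    funext j
    have hj := Set.ext_iff.1 hs j
    rw [Equiv.image_eq_preimage_symm] at hj
    simp only [Set.mem_preimage, Set.mem_ofPred_eq, qvec_ne_zero_iff] at hj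
    rw [Function.comp_apply]
    rcases qvec_eq_zero_or_one false a (σ.symm j) with h1 | h1 <;>
    rcases qvec_eq_zero_or_one s' a' j with h2 | h2 <;> simp [h1, h2] at hj ⊢

end Automorphism

/-- (Theorem 4(ii) and 4(iii)) For a prime power `q ≡ 11 (mod 12)`, the `2q` vectors
`r + 2·1̄` (with `r` ranging over the rows of `±H_{q+1}` other than the all-one row and
its negative) are pairwise distinct `(0,1)`-codewords of `QR_q` of weight `(q+1)/2`
forming a Hadamard `3-(q+1, (q+1)/2, (q−3)/4)` design; moreover, for `q ∈ {11, 23, 47}`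
they are the only `(0,1)`-codewords of weight `(q+1)/2`, and a coordinate permutation
preserves `QR_q` iff it maps the support of each such vector onto the support of one
of them. -/
theorem stmt_19 (q : ℕ) (h12 : q % 12 = 11)
    (F : Type) [Field F] [Fintype F] [DecidableEq F] (hF : Fintype.card F = q) :
    -- the 2q vectors are pairwise distinct
    (∀ (s s' : Bool) (a a' : F), qvec F s a = qvec F s' a' → s = s' ∧ a = a') ∧
    -- each is a (0,1)-codeword of QR_q of weight (q+1)/2
    (∀ (s : Bool) (a : F),
      qvec F s a ∈ QRcode F ∧
      (∀ j, qvec F s a j = 0 ∨ qvec F s a j = 1) ∧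
      (Finset.univ.filter (fun j => qvec F s a j ≠ 0)).card = (q + 1) / 2) ∧
    -- they form a 3-(q+1, (q+1)/2, (q−3)/4) design
    (∀ j₁ j₂ j₃ : Option F, j₁ ≠ j₂ → j₁ ≠ j₃ → j₂ ≠ j₃ →
      (Finset.univ.filter (fun p : Bool × F =>
        qvec F p.1 p.2 j₁ = 1 ∧ qvec F p.1 p.2 j₂ = 1 ∧ qvec F p.1 p.2 j₃ = 1)).card =
        (q - 3) / 4) ∧
    -- Theorem 4(iii)
    (q = 11 ∨ q = 23 ∨ q = 47 →
      -- the 2q vectors are the only (0,1)-codewords of weight (q+1)/2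
      ({v : Option F → ZMod 3 | v ∈ QRcode F ∧ (∀ j, v j = 0 ∨ v j = 1) ∧
          (Finset.univ.filter (fun j => v j ≠ 0)).card = (q + 1) / 2} =
        {v | ∃ (s : Bool) (a : F), v = qvec F s a}) ∧
      -- perm. automorphisms of QR_q = automorphisms of the Hadamard 3-design
      (∀ σ : Equiv.Perm (Option F),
        (∀ c ∈ QRcode F, (fun j => c (σ j)) ∈ QRcode F) ↔
        (∀ (s : Bool) (a : F), ∃ (s' : Bool) (a' : F),
          (⇑σ) '' {j | qvec F s a j ≠ 0} = {j | qvec F s' a' j ≠ 0}))) := by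
  subst hF
  refine ⟨fun _ _ _ _ h => qvec_injective h12 h, fun s a => ⟨qvec_mem h12 s a,
    qvec_eq_zero_or_one s a, card_qvec_ne_zero h12 s a⟩, fun _ _ _ h₁₂ h₁₃ h₂₃ =>
    card_qvec_eq_one_triple h12 h₁₂ h₁₃ h₂₃, fun hq => ⟨?_, forall_comp_mem_QRcode_iff hq⟩⟩
  ext v
  constructor
  · rintro ⟨hvC, hv, hw⟩
    have hw' : hammingNorm v = (Fintype.card F + 1) / 2 := hw
    exact exists_eq_qvec hq hvC hv (by omega)
  · rintro ⟨s, a, rfl⟩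
    exact ⟨qvec_mem h12 s a, qvec_eq_zero_or_one s a, card_qvec_ne_zero h12 s a⟩
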